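/- Let n ≥ 4 and let w be a basic involution in the Weyl group W of type D_n such that Supp(w) ∩ 𝒞₁ = {β} for a single root β. Then β does not divide the Kostant–Kumar polynomial d_w in ℂ[x_1,…,x_n]; that is, for every reduced decomposition of w there is no polynomial g ∈ ℂ[x_1,…,x_n] with d_w = β·g in ℂ(x_1,…,x_n). -/

import Mathlib

/-!
The Weyl group of type `Dₙ`, realized as the group of permutations `w` of `ℤ`
supported on `{±1, …, ±n}` with `w (-i) = - w i` and an even number of sign changes.
-/

open Equiv

/-- The simple reflections of type `Dₙ`, indexed by `i ∈ {1, …, n}`: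
`sᵢ = (i, i+1)(-i, -(i+1))` for `1 ≤ i ≤ n - 1`, and
`sₙ = (n-1, -n)(-(n-1), n)`. -/
def simpleRefl (n : ℕ) (i : ℕ) : Equiv.Perm ℤ :=
  if i < n then Equiv.swap (i : ℤ) ((i : ℤ) + 1) * Equiv.swap (-(i : ℤ)) (-((i : ℤ) + 1))
  else Equiv.swap ((n : ℤ) - 1) (-(n : ℤ)) * Equiv.swap (-((n : ℤ) - 1)) (n : ℤ)

/-- A word in the letters `{1, …, n}` (indices of simple reflections). -/
def IsWord (n : ℕ) (L : List ℕ) : Prop := ∀ i ∈ L, 1 ≤ i ∧ i ≤ n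

/-- The product `s_{i₁} ⋯ s_{i_l}` of the word `L = [i₁, …, i_l]`. -/
def wordProd (n : ℕ) (L : List ℕ) : Equiv.Perm ℤ := (L.map (simpleRefl n)).prod

/-- Membership in the Weyl group `W` of type `Dₙ`: a permutation of `ℤ` commuting with
negation, fixing every integer of absolute value `> n`, and with an even number of
`i ∈ {1, …, n}` such that `w i < 0`. -/
def IsD (n : ℕ) (w : Equiv.Perm ℤ) : Prop :=
  (∀ i : ℤ, w (-i) = -(w i)) ∧ (∀ i : ℤ, (n : ℤ) < |i| → w i = i) ∧
    Even (((Finset.Icc (1 : ℤ) (n : ℤ)).filter fun i => w i < 0).card)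

/-- The length `ℓ(w)`: the minimal number of factors in an expression of `w` as a
product of simple reflections. -/
noncomputable def weylLength (n : ℕ) (w : Equiv.Perm ℤ) : ℕ :=
  sInf {l | ∃ L : List ℕ, IsWord n L ∧ L.length = l ∧ wordProd n L = w}

/-- `L` is a reduced decomposition of `w`. -/
def IsReducedWord (n : ℕ) (w : Equiv.Perm ℤ) (L : List ℕ) : Prop :=
  IsWord n L ∧ wordProd n L = w ∧ L.length = weylLength n w

/-- `w` is a basic involution: `w ∈ W`, `w² = id`, and `w i ≠ -i` for all `i ∈ {1, …, n}`. -/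
def IsBasicInvolution (n : ℕ) (w : Equiv.Perm ℤ) : Prop :=
  IsD n w ∧ w * w = 1 ∧ ∀ i : ℤ, 1 ≤ i → i ≤ (n : ℤ) → w i ≠ -i
open MvPolynomial

/-- The field `ℂ(x₁, …, xₙ)` of rational functions. -/
abbrev KK (n : ℕ) : Type := FractionRing (MvPolynomial (Fin n) ℂ)

/-- The linear polynomial `ε_k` for `k ∈ {±1, …, ±n}`: `ε_k = x_k` for `1 ≤ k ≤ n`
and `ε_{-k} = -ε_k` (and `0` for `k` out of range). -/
noncomputable def epsPoly (n : ℕ) (k : ℤ) : MvPolynomial (Fin n) ℂ :=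
  if h : 1 ≤ k ∧ k ≤ (n : ℤ) then X (⟨(k - 1).toNat, by omega⟩ : Fin n)
  else if h' : 1 ≤ -k ∧ -k ≤ (n : ℤ) then -X (⟨(-k - 1).toNat, by omega⟩ : Fin n)
  else 0

/-- The simple roots: `αᵢ = xᵢ - xᵢ₊₁` for `1 ≤ i ≤ n - 1` and `αₙ = xₙ₋₁ + xₙ`. -/
noncomputable def simpleRootPoly (n : ℕ) (i : ℕ) : MvPolynomial (Fin n) ℂ :=
  if i < n then epsPoly n (i : ℤ) - epsPoly n ((i : ℤ) + 1)
  else epsPoly n ((n : ℤ) - 1) + epsPoly n (n : ℤ)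

/-- The action of a signed permutation `w` on polynomials, sending `xᵢ = ε_i` to
`ε_{w(i)}` (with `1`-based indexing of the variables). -/
noncomputable def polyAct (n : ℕ) (w : Equiv.Perm ℤ) :
    MvPolynomial (Fin n) ℂ →ₐ[ℂ] MvPolynomial (Fin n) ℂ :=
  aeval fun i : Fin n => epsPoly n (w (((i : ℕ) : ℤ) + 1))

/-- The partial product `s_{i₁}^{ε₁} ⋯ s_{i_k}^{ε_k}` of a word `L` with
exponent pattern `E`. -/
def maskedPrefix (n : ℕ) (L : List ℕ) (E : ℕ → Bool) (k : ℕ) : Equiv.Perm ℤ :=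
  ((List.range k).map fun m => if E m then simpleRefl n (L.getD m 0) else 1).prod

/-- The element `c_{w,v}` computed from a word `L = [i₁, …, i_l]` for `w`:
`c_{w,v} = (-1)^l ∑ ∏_{k=1}^{l} (s_{i₁}^{ε₁} ⋯ s_{i_k}^{ε_k}(α_{i_k}))⁻¹`,
the sum over all `(ε₁, …, ε_l) ∈ {0,1}^l` with `s_{i₁}^{ε₁} ⋯ s_{i_l}^{ε_l} = v`. -/
noncomputable def cElem (n : ℕ) (L : List ℕ) (v : Equiv.Perm ℤ) : KK n := by
  classical
  exact (-1 : KK n) ^ L.length *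
    ∑ E : Fin L.length → Bool,
      if maskedPrefix n L (fun m => if h : m < L.length then E ⟨m, h⟩ else false) L.length = v then
        ∏ k ∈ Finset.range L.length,
          (algebraMap (MvPolynomial (Fin n) ℂ) (KK n)
            (polyAct n
              (maskedPrefix n L (fun m => if h : m < L.length then E ⟨m, h⟩ else false) (k + 1))
              (simpleRootPoly n (L.getD k 0))))⁻¹
      else 0

/-- The product `∏_{α ∈ Φ⁺} α` of all positive roots of `Dₙ`. -/
noncomputable def prodPosRoots (n : ℕ) : MvPolynomial (Fin n) ℂ :=
  ∏ p ∈ Finset.univ.filter (fun p : Fin n × Fin n => p.1 < p.2),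
    ((X p.1 - X p.2) * (X p.1 + X p.2))

/-- The Kostant–Kumar polynomial `d_w = (-1)^{ℓ(w)} ⬝ c_w ⬝ ∏_{α ∈ Φ⁺} α`, computed
from a word `L` for `w` (here `c_w = c_{w, id}`). -/
noncomputable def dElem (n : ℕ) (L : List ℕ) : KK n :=
  (-1 : KK n) ^ L.length * cElem n L 1 *
    algebraMap (MvPolynomial (Fin n) ℂ) (KK n) (prodPosRoots n)

/-- The first column `𝒞₁ = {ε₁ - ε_j, ε₁ + ε_j : 2 ≤ j ≤ n}` of `Φ⁺`, as a set of
linear polynomials (`ε_j` is the variable `X (j-1)`). -/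
def col1Set (n : ℕ) : Set (MvPolynomial (Fin n) ℂ) :=
  {p | ∃ i j : Fin n, (i : ℕ) = 0 ∧ 0 < (j : ℕ) ∧ (p = X i - X j ∨ p = X i + X j)}

/-- The support of an involution `w`, as a set of linear polynomials: it contains
`ε_i - ε_j` whenever `1 ≤ i < j ≤ n` and `w(i) = j`, and `ε_i + ε_j` whenever
`1 ≤ i < j ≤ n` and `w(i) = -j`. -/
def suppPoly (n : ℕ) (w : Equiv.Perm ℤ) : Set (MvPolynomial (Fin n) ℂ) :=
  {p | ∃ i j : Fin n, i < j ∧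
    ((w (((i : ℕ) : ℤ) + 1) = ((j : ℕ) : ℤ) + 1 ∧ p = X i - X j) ∨
     (w (((i : ℕ) : ℤ) + 1) = -(((j : ℕ) : ℤ) + 1) ∧ p = X i + X j))}

/-- The index `a` for which the `i`-th simple root is `ε_a - ε_b`. -/
def rootFst (n i : ℕ) : ℤ := if i < n then i else n - 1

/-- The index `b` for which the `i`-th simple root is `ε_a - ε_b`. -/
def rootSnd (n i : ℕ) : ℤ := if i < n then i + 1 else -n

/-- The value of the `i`-th simple root at the point with coordinates `h`. -/
def rootVal (n i : ℕ) (h : ℤ → ℝ) : ℝ := h (rootFst n i) - h (rootSnd n i)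

/-- The reflection in the root `ε_a - ε_b`. -/
def pairRefl (a b : ℤ) : Perm ℤ := swap a b * swap (-a) (-b)

lemma simpleRefl_eq_pairRefl (n i : ℕ) :
    simpleRefl n i = pairRefl (rootFst n i) (rootSnd n i) := by
  unfold simpleRefl pairRefl rootFst rootSnd
  split_ifs <;> simp

/-- `m ≤ |k| ≤ n`. -/
def Idx (m : ℤ) (n : ℕ) (k : ℤ) : Prop := (m ≤ k ∧ k ≤ n) ∨ (m ≤ -k ∧ -k ≤ n)

lemma Idx.neg {m : ℤ} {n : ℕ} {k : ℤ} (h : Idx m n k) : Idx m n (-k) := by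
  unfold Idx at *; omega

lemma Idx.mono {m m' : ℤ} {n : ℕ} {k : ℤ} (h : Idx m n k) (hm : m' ≤ m) : Idx m' n k := by
  unfold Idx at *; omega

section SimpleReflections

variable {n i : ℕ}

lemma simpleRefl_apply_of_lt (hi : 1 ≤ i) (hin : i < n) (x : ℤ) :
    simpleRefl n i x = if x = i then (i : ℤ) + 1 else if x = i + 1 then (i : ℤ) else
      if x = -i then -((i : ℤ) + 1) else if x = -(i + 1) then -(i : ℤ) else x := by
  simp only [simpleRefl, hin, if_true, Perm.mul_apply, swap_apply_def]
  split_ifs <;> omega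

lemma simpleRefl_apply_last (hn : 4 ≤ n) (x : ℤ) :
    simpleRefl n n x = if x = n - 1 then -(n : ℤ) else if x = -n then (n : ℤ) - 1 else
      if x = -(n - 1) then (n : ℤ) else if x = n then -((n : ℤ) - 1) else x := by
  simp only [simpleRefl, lt_irrefl, if_false, Perm.mul_apply, swap_apply_def]
  split_ifs <;> omega

lemma simpleRefl_neg (hn : 4 ≤ n) (hi : 1 ≤ i) (hin : i ≤ n) (x : ℤ) :
    simpleRefl n i (-x) = -simpleRefl n i x := by
  rcases hin.lt_or_eq with h | rfl
  · simp only [simpleRefl_apply_of_lt hi h]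
    split_ifs <;> omega
  · simp only [simpleRefl_apply_last hn]
    split_ifs <;> omega

lemma simpleRefl_simpleRefl (hn : 4 ≤ n) (hi : 1 ≤ i) (hin : i ≤ n) (x : ℤ) :
    simpleRefl n i (simpleRefl n i x) = x := by
  rcases hin.lt_or_eq with h | rfl
  · simp only [simpleRefl_apply_of_lt hi h]
    split_ifs <;> omega
  · simp only [simpleRefl_apply_last hn]
    split_ifs <;> omega

lemma simpleRefl_mul_self (hn : 4 ≤ n) (hi : 1 ≤ i) (hin : i ≤ n) :
    simpleRefl n i * simpleRefl n i = 1 :=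
  Equiv.ext fun x => simpleRefl_simpleRefl hn hi hin x

lemma simpleRefl_inv (hn : 4 ≤ n) (hi : 1 ≤ i) (hin : i ≤ n) :
    (simpleRefl n i)⁻¹ = simpleRefl n i :=
  inv_eq_of_mul_eq_one_left (simpleRefl_mul_self hn hi hin)

lemma simpleRefl_mul_cancel (hn : 4 ≤ n) (hi : 1 ≤ i) (hin : i ≤ n) (w : Perm ℤ) :
    simpleRefl n i * (simpleRefl n i * w) = w := by
  rw [← mul_assoc, simpleRefl_mul_self hn hi hin, one_mul]

lemma mul_simpleRefl_cancel (hn : 4 ≤ n) (hi : 1 ≤ i) (hin : i ≤ n) (w : Perm ℤ) :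
    w * simpleRefl n i * simpleRefl n i = w := by
  rw [mul_assoc, simpleRefl_mul_self hn hi hin, mul_one]

lemma simpleRefl_idx (hn : 4 ≤ n) (hi : 1 ≤ i) (hin : i ≤ n) {x : ℤ} (hx : Idx 1 n x) :
    Idx 1 n (simpleRefl n i x) := by
  unfold Idx at *
  rcases hin.lt_or_eq with h | rfl
  · simp only [simpleRefl_apply_of_lt hi h]
    split_ifs <;> omega
  · simp only [simpleRefl_apply_last hn]
    split_ifs <;> omega

lemma simpleRefl_idx_two (hn : 4 ≤ n) (hi : 2 ≤ i) (hin : i ≤ n) {x : ℤ} (hx : Idx 2 n x) :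
    Idx 2 n (simpleRefl n i x) := by
  unfold Idx at *
  rcases hin.lt_or_eq with h | rfl
  · simp only [simpleRefl_apply_of_lt (by omega : 1 ≤ i) h]
    split_ifs <;> omega
  · simp only [simpleRefl_apply_last hn]
    split_ifs <;> omega

lemma simpleRefl_one_of_two_le (hn : 4 ≤ n) (hi : 2 ≤ i) (hin : i ≤ n) :
    simpleRefl n i 1 = 1 := by
  rcases hin.lt_or_eq with h | rfl
  · simp only [simpleRefl_apply_of_lt (by omega : 1 ≤ i) h]
    split_ifs <;> omega
  · simp only [simpleRefl_apply_last hn]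
    split_ifs <;> omega

lemma simpleRefl_two_of_three_le (hn : 4 ≤ n) (hi : 3 ≤ i) (hin : i ≤ n) :
    simpleRefl n i 2 = 2 := by
  rcases hin.lt_or_eq with h | rfl
  · simp only [simpleRefl_apply_of_lt (by omega : 1 ≤ i) h]
    split_ifs <;> omega
  · simp only [simpleRefl_apply_last hn]
    split_ifs <;> omega

lemma simpleRefl_rootFst (hn : 4 ≤ n) (hi : 1 ≤ i) (hin : i ≤ n) :
    simpleRefl n i (rootFst n i) = rootSnd n i := by
  rcases hin.lt_or_eq with h | rfl
  · simp only [simpleRefl_apply_of_lt hi h, rootFst, rootSnd]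
    split_ifs <;> omega
  · simp only [simpleRefl_apply_last hn, rootFst, rootSnd]
    split_ifs <;> omega

lemma simpleRefl_rootSnd (hn : 4 ≤ n) (hi : 1 ≤ i) (hin : i ≤ n) :
    simpleRefl n i (rootSnd n i) = rootFst n i := by
  rw [← simpleRefl_rootFst hn hi hin, simpleRefl_simpleRefl hn hi hin]

lemma rootVal_comp_self (hn : 4 ≤ n) (hi : 1 ≤ i) (hin : i ≤ n) (h : ℤ → ℝ) :
    rootVal n i (h ∘ simpleRefl n i) = -rootVal n i h := by
  simp [rootVal, simpleRefl_rootFst hn hi hin, simpleRefl_rootSnd hn hi hin]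

lemma rootFst_idx (hn : 4 ≤ n) (hi : 1 ≤ i) : Idx 1 n (rootFst n i) := by
  unfold rootFst Idx; split_ifs <;> omega

lemma rootSnd_idx (hn : 4 ≤ n) (hi : 1 ≤ i) : Idx 1 n (rootSnd n i) := by
  unfold rootSnd Idx; split_ifs <;> omega

lemma rootFst_idx_two (hn : 4 ≤ n) (hi : 2 ≤ i) : Idx 2 n (rootFst n i) := by
  unfold rootFst Idx; split_ifs <;> omega

lemma rootSnd_idx_two (hn : 4 ≤ n) (hi : 2 ≤ i) : Idx 2 n (rootSnd n i) := by
  unfold rootSnd Idx; split_ifs <;> omega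

lemma rootFst_ne (hn : 4 ≤ n) (hi : 1 ≤ i) (hin : i ≤ n) :
    rootFst n i ≠ rootSnd n i ∧ rootFst n i ≠ -rootSnd n i := by
  unfold rootFst rootSnd; split_ifs <;> omega

lemma pairRefl_neg_swap {a b : ℤ} (ha : a ≠ 0) (hb : b ≠ 0) :
    pairRefl (-b) (-a) = pairRefl a b := by
  ext x
  simp only [pairRefl, neg_neg, Perm.mul_apply, swap_apply_def]
  split_ifs <;> omega

lemma mul_pairRefl {g : Perm ℤ} (hg : ∀ k, g (-k) = -g k) (a b : ℤ) :
    g * pairRefl a b = pairRefl (g a) (g b) * g := by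
  rw [pairRefl, ← mul_assoc, mul_swap_eq_swap_mul g a b, mul_assoc,
    mul_swap_eq_swap_mul g (-a) (-b), hg, hg, ← mul_assoc, pairRefl]

lemma simpleRefl_mul_simpleRefl {j : ℕ} (hn : 4 ≤ n) (hi : 1 ≤ i) (hin : i ≤ n) :
    simpleRefl n i * simpleRefl n j =
      pairRefl (simpleRefl n i (rootFst n j)) (simpleRefl n i (rootSnd n j)) * simpleRefl n i := by
  rw [simpleRefl_eq_pairRefl n j, mul_pairRefl (simpleRefl_neg hn hi hin)]

lemma simpleRefl_comm_of_lt {j : ℕ} (hn : 4 ≤ n) (hi : 1 ≤ i) (hij : i < j) (hjn : j ≤ n)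
    (hc : j < n ∧ i + 1 < j ∨ j = n ∧ i + 2 ≠ n) :
    simpleRefl n i * simpleRefl n j = simpleRefl n j * simpleRefl n i ∧
      ∀ h : ℤ → ℝ, (∀ k, h (-k) = -h k) →
        rootVal n j (h ∘ simpleRefl n i) = rootVal n j h ∧
        rootVal n i (h ∘ simpleRefl n j) = rootVal n i h := by
  have hi' : i < n := by omega
  have hj : 1 ≤ j := by omega
  have h1 : (simpleRefl n i (rootFst n j) = rootFst n j ∧
      simpleRefl n i (rootSnd n j) = rootSnd n j ∧ simpleRefl n j (rootFst n i) = rootFst n i ∧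
      simpleRefl n j (rootSnd n i) = rootSnd n i) ∨
      (simpleRefl n i (rootFst n j) = -rootSnd n j ∧
      simpleRefl n i (rootSnd n j) = -rootFst n j ∧ simpleRefl n j (rootFst n i) = -rootSnd n i ∧
      simpleRefl n j (rootSnd n i) = -rootFst n i) := by
    rcases hc with hc | ⟨rfl, hc⟩
    · left
      simp only [rootFst, rootSnd, hi', hc.1, if_true]
      simp only [simpleRefl_apply_of_lt hi hi', simpleRefl_apply_of_lt hj hc.1]
      refine ⟨?_, ?_, ?_, ?_⟩ <;> split_ifs <;> omega
    · simp only [rootFst, rootSnd, hi', lt_irrefl, if_true, if_false]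
      by_cases h : i + 1 = j
      · right
        simp only [simpleRefl_apply_of_lt hi hi', simpleRefl_apply_last hn]
        refine ⟨?_, ?_, ?_, ?_⟩ <;> split_ifs <;> omega
      · left
        simp only [simpleRefl_apply_of_lt hi hi', simpleRefl_apply_last hn]
        refine ⟨?_, ?_, ?_, ?_⟩ <;> split_ifs <;> omega
  refine ⟨?_, fun h hh => ?_⟩
  · rw [simpleRefl_mul_simpleRefl hn hi hi'.le]
    congr 1
    rcases h1 with ⟨e, e', -⟩ | ⟨e, e', -⟩ <;> rw [e, e']
    · rw [simpleRefl_eq_pairRefl n j]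
    · have ha := rootFst_idx hn hj
      have hb := rootSnd_idx hn hj
      unfold Idx at ha hb
      rw [simpleRefl_eq_pairRefl n j, pairRefl_neg_swap (by omega) (by omega)]
  · rcases h1 with ⟨e1, e2, e3, e4⟩ | ⟨e1, e2, e3, e4⟩ <;>
    simp only [rootVal, Function.comp, e1, e2, e3, e4, hh] <;> constructor <;> first | trivial | ring

lemma simpleRefl_braid_of_lt {j : ℕ} (hn : 4 ≤ n) (hi : 1 ≤ i) (hij : i < j) (hjn : j ≤ n)
    (hc : j < n ∧ i + 1 = j ∨ j = n ∧ i + 2 = n) :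
    simpleRefl n i * simpleRefl n j * simpleRefl n i =
        simpleRefl n j * simpleRefl n i * simpleRefl n j ∧
      ∀ h : ℤ → ℝ,
        rootVal n j (h ∘ simpleRefl n i) = rootVal n i h + rootVal n j h ∧
        rootVal n i (h ∘ simpleRefl n j) = rootVal n i h + rootVal n j h := by
  have hi' : i < n := by omega
  have hj : 1 ≤ j := by omega
  have h1 : rootSnd n i = rootFst n j ∧ simpleRefl n i (rootSnd n j) = rootSnd n j ∧
      simpleRefl n j (rootFst n i) = rootFst n i := by
    rcases hc with ⟨hc, hc'⟩ | ⟨rfl, hc⟩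
    · simp only [rootFst, rootSnd, hi', hc, if_true]
      simp only [simpleRefl_apply_of_lt hi hi', simpleRefl_apply_of_lt hj hc]
      refine ⟨?_, ?_, ?_⟩ <;> (try split_ifs) <;> omega
    · simp only [rootFst, rootSnd, hi', lt_irrefl, if_true, if_false]
      simp only [simpleRefl_apply_of_lt hi hi', simpleRefl_apply_last hn]
      refine ⟨?_, ?_, ?_⟩ <;> (try split_ifs) <;> omega
  obtain ⟨e1, e2, e3⟩ := h1
  have e4 := simpleRefl_rootSnd hn hi hi'.le
  have e5 := simpleRefl_rootFst hn hj hjn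
  refine ⟨?_, fun h => ?_⟩
  · rw [simpleRefl_mul_simpleRefl hn hi hi'.le, simpleRefl_mul_simpleRefl hn hj hjn, mul_assoc,
      mul_assoc, simpleRefl_mul_self hn hi hi'.le, simpleRefl_mul_self hn hj hjn, e2, e3, ← e1, e4,
      e1, e5]
  · simp only [rootVal, Function.comp, e2, e3, ← e1, e4]
    simp only [e1, e5]
    constructor <;> ring

/-- Two distinct simple reflections either commute or satisfy the braid relation of length `3`;
this is recorded together with the effect on the values of the corresponding simple roots. -/
lemma simpleRefl_pair {j : ℕ} (hn : 4 ≤ n) (hi : 1 ≤ i) (hin : i ≤ n) (hj : 1 ≤ j) (hjn : j ≤ n)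
    (hij : i ≠ j) :
    (simpleRefl n i * simpleRefl n j = simpleRefl n j * simpleRefl n i ∧
      ∀ h : ℤ → ℝ, (∀ k, h (-k) = -h k) →
        rootVal n j (h ∘ simpleRefl n i) = rootVal n j h ∧
        rootVal n i (h ∘ simpleRefl n j) = rootVal n i h) ∨
    (simpleRefl n i * simpleRefl n j * simpleRefl n i =
        simpleRefl n j * simpleRefl n i * simpleRefl n j ∧
      ∀ h : ℤ → ℝ,
        rootVal n j (h ∘ simpleRefl n i) = rootVal n i h + rootVal n j h ∧
        rootVal n i (h ∘ simpleRefl n j) = rootVal n i h + rootVal n j h) := by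
  wlog hlt : i < j generalizing i j
  · rcases this hj hjn hi hin hij.symm (by omega) with ⟨e, f⟩ | ⟨e, f⟩
    · exact Or.inl ⟨e.symm, fun h hh => (f h hh).symm⟩
    · refine Or.inr ⟨e.symm, fun h => ?_⟩
      rw [add_comm]
      exact (f h).symm
  by_cases hc : j < n ∧ i + 1 < j ∨ j = n ∧ i + 2 ≠ n
  · exact Or.inl (simpleRefl_comm_of_lt hn hi hlt hjn hc)
  · exact Or.inr (simpleRefl_braid_of_lt hn hi hlt hjn (by omega))

/-- The height function of the ordering `1 > 2 > ⋯ > n - 1 > ±n > -(n - 1) > ⋯ > -1`, which is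
the point `(n - 1, n - 2, …, 0)` of the dominant chamber. -/
def height (n : ℕ) (k : ℤ) : ℤ := if 0 < k then n - k else if k < 0 then -n - k else 0

lemma height_neg (n : ℕ) (k : ℤ) : height n (-k) = -height n k := by
  unfold height; split_ifs <;> omega

lemma height_ne {a b : ℤ} (ha : Idx 1 n a) (hb : Idx 1 n b)
    (h1 : a ≠ b) (h2 : a ≠ -b) : height n a ≠ height n b := by
  unfold Idx at *; unfold height; split_ifs <;> omega

lemma height_simpleRefl (hn : 4 ≤ n) (hi : 1 ≤ i) (hin : i ≤ n) (x : ℤ) :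
    height n x ≤ height n (simpleRefl n i x) + 1 := by
  rcases hin.lt_or_eq with h | rfl
  · simp only [simpleRefl_apply_of_lt hi h, height]
    split_ifs <;> omega
  · simp only [simpleRefl_apply_last hn, height]
    split_ifs <;> omega

lemma height_rootFst (hn : 4 ≤ n) (hi : 1 ≤ i) :
    height n (rootFst n i) = height n (rootSnd n i) + 1 := by
  unfold height rootFst rootSnd; split_ifs <;> omega

lemma height_simpleRefl_cases (hn : 4 ≤ n) (hi : 1 ≤ i) (hin : i ≤ n) (x : ℤ) :
    ((x = rootFst n i ∨ x = -rootSnd n i) ∧ height n (simpleRefl n i x) = height n x - 1) ∨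
    ((x = rootSnd n i ∨ x = -rootFst n i) ∧ height n (simpleRefl n i x) = height n x + 1) ∨
    height n (simpleRefl n i x) = height n x := by
  rcases hin.lt_or_eq with h | rfl
  · simp only [simpleRefl_apply_of_lt hi h, rootFst, rootSnd, h, if_true, height]
    split_ifs <;> omega
  · simp only [simpleRefl_apply_last hn, rootFst, rootSnd, lt_irrefl, if_false, height]
    split_ifs <;> omega

/-- A simple reflection makes no positive root negative except its own simple root. -/
lemma eq_root_of_height (hn : 4 ≤ n) (hi : 1 ≤ i) (hin : i ≤ n) {a b : ℤ} (hab : a ≠ -b)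
    (h1 : height n b < height n a)
    (h2 : height n (simpleRefl n i a) < height n (simpleRefl n i b)) :
    (a = rootFst n i ∧ b = rootSnd n i) ∨ (a = -rootSnd n i ∧ b = -rootFst n i) := by
  have ha := height_simpleRefl_cases hn hi hin a
  have hb := height_simpleRefl_cases hn hi hin b
  have := height_rootFst hn hi
  have := height_neg n (rootFst n i)
  have := height_neg n (rootSnd n i)
  omega

end SimpleReflections

/-- The group generated by the simple reflections. -/
def Gen (n : ℕ) (w : Perm ℤ) : Prop := ∃ L, IsWord n L ∧ wordProd n L = w

section Words

variable {n i : ℕ} {w : Perm ℤ}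

lemma IsWord.head {L : List ℕ} (h : IsWord n (i :: L)) : 1 ≤ i ∧ i ≤ n := h i (by simp)

lemma IsWord.tail {L : List ℕ} (h : IsWord n (i :: L)) : IsWord n L :=
  fun j hj => h j (by simp [hj])

lemma IsWord.cons {L : List ℕ} (hi : 1 ≤ i) (hin : i ≤ n) (h : IsWord n L) :
    IsWord n (i :: L) := by
  intro j hj
  rcases List.mem_cons.1 hj with rfl | hj
  · exact ⟨hi, hin⟩
  · exact h j hj

lemma IsWord.nil : IsWord n [] := fun i hi => by simp at hi

lemma IsWord.append {L L' : List ℕ} (h : IsWord n L) (h' : IsWord n L') : IsWord n (L ++ L') :=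
  fun i hi => (List.mem_append.1 hi).elim (h i) (h' i)

lemma IsWord.reverse {L : List ℕ} (h : IsWord n L) : IsWord n L.reverse :=
  fun i hi => h i (List.mem_reverse.1 hi)

lemma wordProd_nil : wordProd n [] = 1 := by simp [wordProd]

lemma wordProd_cons (L : List ℕ) : wordProd n (i :: L) = simpleRefl n i * wordProd n L := by
  simp [wordProd]

lemma wordProd_append (L L' : List ℕ) :
    wordProd n (L ++ L') = wordProd n L * wordProd n L' := by
  simp [wordProd]

lemma wordProd_reverse (hn : 4 ≤ n) {L : List ℕ} (hL : IsWord n L) :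
    wordProd n L.reverse = (wordProd n L)⁻¹ := by
  induction L with
  | nil => simp [wordProd]
  | cons i L ih =>
    rw [List.reverse_cons, wordProd_append, ih hL.tail, wordProd_cons, wordProd_cons, wordProd_nil,
      mul_one, mul_inv_rev, simpleRefl_inv hn hL.head.1 hL.head.2]

lemma gen_wordProd {L : List ℕ} (hL : IsWord n L) : Gen n (wordProd n L) := ⟨L, hL, rfl⟩

lemma Gen.one : Gen n 1 := ⟨[], IsWord.nil, wordProd_nil⟩

lemma Gen.mul {v : Perm ℤ} (hv : Gen n v) (hw : Gen n w) : Gen n (v * w) := by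
  obtain ⟨L, hL, rfl⟩ := hv
  obtain ⟨L', hL', rfl⟩ := hw
  exact ⟨L ++ L', hL.append hL', wordProd_append _ _⟩

lemma Gen.inv (hn : 4 ≤ n) (hw : Gen n w) : Gen n w⁻¹ := by
  obtain ⟨L, hL, rfl⟩ := hw
  exact ⟨L.reverse, hL.reverse, wordProd_reverse hn hL⟩

lemma gen_simpleRefl (hi : 1 ≤ i) (hin : i ≤ n) : Gen n (simpleRefl n i) :=
  ⟨[i], IsWord.nil.cons hi hin, by simp [wordProd]⟩

lemma Gen.induction (P : Perm ℤ → Prop) (h1 : P 1)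
    (hs : ∀ i v, 1 ≤ i → i ≤ n → Gen n v → P v → P (simpleRefl n i * v)) (hw : Gen n w) : P w := by
  obtain ⟨L, hL, rfl⟩ := hw
  induction L with
  | nil => exact h1
  | cons i L ih =>
    rw [wordProd_cons]
    exact hs i _ hL.head.1 hL.head.2 (gen_wordProd hL.tail) (ih hL.tail)

lemma Gen.map_neg (hn : 4 ≤ n) (hw : Gen n w) (x : ℤ) : w (-x) = -w x := by
  refine Gen.induction (fun w => w (-x) = -w x) rfl (fun i v hi hin _ hv => ?_) hw
  rw [Perm.mul_apply, hv, simpleRefl_neg hn hi hin, Perm.mul_apply]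

lemma Gen.idx (hn : 4 ≤ n) (hw : Gen n w) {x : ℤ} (hx : Idx 1 n x) : Idx 1 n (w x) := by
  refine Gen.induction (fun w => Idx 1 n (w x)) hx (fun i v hi hin _ hv => ?_) hw
  exact simpleRefl_idx hn hi hin hv

lemma Gen.apply_of_not_idx (hn : 4 ≤ n) (hw : Gen n w) {x : ℤ} (hx : ¬ Idx 1 n x) : w x = x := by
  refine Gen.induction (fun w => w x = x) rfl (fun i v hi hin _ hv => ?_) hw
  rw [Perm.mul_apply, hv]
  unfold Idx at hx
  rcases hin.lt_or_eq with h | rfl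
  · simp only [simpleRefl_apply_of_lt hi h]
    split_ifs <;> omega
  · simp only [simpleRefl_apply_last hn]
    split_ifs <;> omega

/-! ### Length and descents -/

lemma weylLength_wordProd_le {L : List ℕ} (hL : IsWord n L) :
    weylLength n (wordProd n L) ≤ L.length := Nat.sInf_le ⟨L, hL, rfl, rfl⟩

lemma Gen.exists_reduced (hw : Gen n w) : ∃ L, IsReducedWord n w L := by
  obtain ⟨L, hL, e⟩ := hw
  obtain ⟨L', h1, h2, h3⟩ := Nat.sInf_mem
    (s := {l | ∃ L : List ℕ, IsWord n L ∧ L.length = l ∧ wordProd n L = w}) ⟨_, L, hL, rfl, e⟩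
  exact ⟨L', h1, h3, h2⟩

lemma IsReducedWord.gen {L : List ℕ} (h : IsReducedWord n w L) : Gen n w := ⟨L, h.1, h.2.1⟩

lemma weylLength_simpleRefl_mul_le (hi : 1 ≤ i) (hin : i ≤ n) (hw : Gen n w) :
    weylLength n (simpleRefl n i * w) ≤ weylLength n w + 1 := by
  obtain ⟨L, hL, rfl, e⟩ := hw.exists_reduced
  rw [← e, ← wordProd_cons]
  exact weylLength_wordProd_le (hL.cons hi hin)

lemma weylLength_inv_le (hn : 4 ≤ n) (hw : Gen n w) : weylLength n w⁻¹ ≤ weylLength n w := by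
  obtain ⟨L, hL, rfl, e⟩ := hw.exists_reduced
  rw [← e, ← wordProd_reverse hn hL, ← List.length_reverse]
  exact weylLength_wordProd_le hL.reverse

lemma weylLength_inv (hn : 4 ≤ n) (hw : Gen n w) : weylLength n w⁻¹ = weylLength n w :=
  (weylLength_inv_le hn hw).antisymm (by simpa using weylLength_inv_le hn (hw.inv hn))

/-- The exchange property: a positive root `ε_a - ε_b` made negative by `w⁻¹` gives a word for
`s_{ε_a - ε_b} w` with one letter less. -/
lemma exists_word_pairRefl_mul (hn : 4 ≤ n) {L : List ℕ} (hL : IsWord n L) {a b : ℤ}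
    (ha : Idx 1 n a) (hb : Idx 1 n b) (hab : a ≠ -b) (h1 : height n b < height n a)
    (h2 : height n ((wordProd n L)⁻¹ a) < height n ((wordProd n L)⁻¹ b)) :
    ∃ L', IsWord n L' ∧ L'.length + 1 = L.length ∧
      wordProd n L' = pairRefl a b * wordProd n L := by
  induction L generalizing a b with
  | nil => simp only [wordProd_nil, inv_one, Perm.one_apply] at h2; omega
  | cons i L ih =>
    obtain ⟨hi, hin⟩ := hL.head
    rw [wordProd_cons, mul_inv_rev, simpleRefl_inv hn hi hin, Perm.mul_apply, Perm.mul_apply] at h2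
    by_cases h : height n (simpleRefl n i a) < height n (simpleRefl n i b)
    · refine ⟨L, hL.tail, rfl, ?_⟩
      have : pairRefl a b = simpleRefl n i := by
        rw [simpleRefl_eq_pairRefl]
        rcases eq_root_of_height hn hi hin hab h1 h with ⟨rfl, rfl⟩ | ⟨rfl, rfl⟩
        · rfl
        · have ha := rootFst_idx hn hi
          have hb := rootSnd_idx hn hi
          unfold Idx at ha hb
          exact pairRefl_neg_swap (by omega) (by omega)
      rw [this, wordProd_cons, simpleRefl_mul_cancel hn hi hin]
    · have hab' : simpleRefl n i a ≠ -simpleRefl n i b := by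
        rw [← simpleRefl_neg hn hi hin]
        exact fun e => hab ((simpleRefl n i).injective e)
      have hne := height_ne (simpleRefl_idx hn hi hin ha) (simpleRefl_idx hn hi hin hb)
        (fun e => by rw [(simpleRefl n i).injective e] at h1; omega) hab'
      obtain ⟨L', hL', hl, e⟩ := ih hL.tail (simpleRefl_idx hn hi hin ha)
        (simpleRefl_idx hn hi hin hb) hab' (by omega) h2
      refine ⟨i :: L', hL'.cons hi hin, by simp [hl], ?_⟩
      rw [wordProd_cons, wordProd_cons, e, ← mul_assoc, mul_pairRefl (simpleRefl_neg hn hi hin),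
        simpleRefl_simpleRefl hn hi hin, simpleRefl_simpleRefl hn hi hin, mul_assoc]

/-- The point `(n - 1, n - 2, …, 0)` of the dominant chamber. -/
def dom (n : ℕ) (k : ℤ) : ℝ := height n k

lemma weylLength_of_descent (hn : 4 ≤ n) (hi : 1 ≤ i) (hin : i ≤ n) (hw : Gen n w)
    (h : rootVal n i (dom n ∘ ⇑w⁻¹) < 0) :
    weylLength n (simpleRefl n i * w) + 1 = weylLength n w := by
  obtain ⟨L, hL, rfl, e⟩ := hw.exists_reduced
  have h' : height n ((wordProd n L)⁻¹ (rootFst n i)) < height n ((wordProd n L)⁻¹ (rootSnd n i)) := by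
    simp only [rootVal, Function.comp, dom] at h
    exact_mod_cast sub_neg.1 h
  obtain ⟨L', hL', hl, e'⟩ := exists_word_pairRefl_mul hn hL (rootFst_idx hn hi)
    (rootSnd_idx hn hi) (rootFst_ne hn hi hin).2 (by rw [height_rootFst hn hi]; omega) h'
  rw [← simpleRefl_eq_pairRefl] at e'
  have h1 := weylLength_wordProd_le hL'
  have h2 := weylLength_simpleRefl_mul_le hi hin (gen_wordProd hL')
  rw [e', simpleRefl_mul_cancel hn hi hin] at h2
  rw [e'] at h1
  omega

lemma rootVal_comp_mul_simpleRefl (hn : 4 ≤ n) (hi : 1 ≤ i) (hin : i ≤ n) (h : ℤ → ℝ)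
    (w : Perm ℤ) : rootVal n i (h ∘ ⇑(w * simpleRefl n i)) = -rootVal n i (h ∘ ⇑w) := by
  rw [Perm.coe_mul, ← Function.comp_assoc, rootVal_comp_self hn hi hin]

lemma weylLength_of_ascent (hn : 4 ≤ n) (hi : 1 ≤ i) (hin : i ≤ n) (hw : Gen n w)
    (h : 0 < rootVal n i (dom n ∘ ⇑w⁻¹)) :
    weylLength n (simpleRefl n i * w) = weylLength n w + 1 := by
  rw [← weylLength_of_descent hn hi hin ((gen_simpleRefl hi hin).mul hw),
    simpleRefl_mul_cancel hn hi hin]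
  rw [mul_inv_rev, simpleRefl_inv hn hi hin, rootVal_comp_mul_simpleRefl hn hi hin]
  linarith

lemma weylLength_mul_of_descent (hn : 4 ≤ n) (hi : 1 ≤ i) (hin : i ≤ n) (hw : Gen n w)
    (h : rootVal n i (dom n ∘ ⇑w) < 0) :
    weylLength n (w * simpleRefl n i) + 1 = weylLength n w := by
  have := weylLength_of_descent hn hi hin (hw.inv hn) (by rwa [inv_inv])
  rwa [weylLength_inv hn hw, ← weylLength_inv hn ((gen_simpleRefl hi hin).mul (hw.inv hn)),
    mul_inv_rev, inv_inv, simpleRefl_inv hn hi hin] at this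

lemma weylLength_mul_of_ascent (hn : 4 ≤ n) (hi : 1 ≤ i) (hin : i ≤ n) (hw : Gen n w)
    (h : 0 < rootVal n i (dom n ∘ ⇑w)) :
    weylLength n (w * simpleRefl n i) = weylLength n w + 1 := by
  have := weylLength_of_ascent hn hi hin (hw.inv hn) (by rwa [inv_inv])
  rwa [weylLength_inv hn hw, ← weylLength_inv hn ((gen_simpleRefl hi hin).mul (hw.inv hn)),
    mul_inv_rev, inv_inv, simpleRefl_inv hn hi hin] at this

/-- A point on none of the root hyperplanes with indices of absolute value at least `m`. -/
def Regular (m : ℤ) (n : ℕ) (h : ℤ → ℝ) : Prop :=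
  (∀ k, h (-k) = -h k) ∧ ∀ a b, Idx m n a → Idx m n b → a ≠ b → a ≠ -b → h a ≠ h b

lemma Regular.comp (hn : 4 ≤ n) {h : ℤ → ℝ} (hh : Regular 1 n h) (hw : Gen n w) :
    Regular 1 n (h ∘ ⇑w) := by
  refine ⟨fun k => by simp [hw.map_neg hn, hh.1], fun a b ha hb hab hab' => ?_⟩
  refine hh.2 _ _ (hw.idx hn ha) (hw.idx hn hb) (fun e => hab (w.injective e)) fun e => hab' ?_
  rw [← hw.map_neg hn] at e
  exact w.injective e

lemma Regular.rootVal_ne {h : ℤ → ℝ} (hh : Regular 1 n h) (hn : 4 ≤ n) (hi : 1 ≤ i)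
    (hin : i ≤ n) : rootVal n i h ≠ 0 :=
  sub_ne_zero.2 (hh.2 _ _ (rootFst_idx hn hi) (rootSnd_idx hn hi) (rootFst_ne hn hi hin).1
    (rootFst_ne hn hi hin).2)

lemma regular_dom : Regular 1 n (dom n) := by
  refine ⟨fun k => by simp [dom, height_neg], fun a b ha hb hab hab' e => ?_⟩
  simp only [dom, Int.cast_inj] at e
  exact height_ne ha hb hab hab' e

lemma rootVal_dom_comp_ne (hn : 4 ≤ n) (hi : 1 ≤ i) (hin : i ≤ n) (hw : Gen n w) :
    rootVal n i (dom n ∘ ⇑w) ≠ 0 :=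
  (regular_dom.comp hn hw).rootVal_ne hn hi hin

lemma weylLength_one : weylLength n 1 = 0 := by
  simpa [wordProd_nil] using weylLength_wordProd_le (n := n) IsWord.nil

/-- The first letter of a reduced word is a left descent. -/
lemma IsReducedWord.tail {L : List ℕ} (hn : 4 ≤ n) (h : IsReducedWord n w (i :: L)) :
    IsReducedWord n (simpleRefl n i * w) L ∧ rootVal n i (dom n ∘ ⇑w⁻¹) < 0 := by
  obtain ⟨hi, hin⟩ := h.1.head
  have hw := h.gen
  obtain ⟨h1, rfl, h3⟩ := h
  have e : wordProd n L = simpleRefl n i * wordProd n (i :: L) := by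
    rw [wordProd_cons, simpleRefl_mul_cancel hn hi hin]
  have hle := weylLength_wordProd_le h1.tail
  rw [e] at hle
  rw [List.length_cons] at h3
  rcases (rootVal_dom_comp_ne hn hi hin (hw.inv hn)).lt_or_gt with h | h
  · have := weylLength_of_descent hn hi hin hw h
    exact ⟨⟨h1.tail, e, by omega⟩, h⟩
  · have := weylLength_of_ascent hn hi hin hw h
    omega

lemma IsReducedWord.cons {L : List ℕ} (hn : 4 ≤ n) (hi : 1 ≤ i) (hin : i ≤ n) (hw : Gen n w)
    (hd : rootVal n i (dom n ∘ ⇑w⁻¹) < 0) (h : IsReducedWord n (simpleRefl n i * w) L) :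
    IsReducedWord n w (i :: L) := by
  refine ⟨h.1.cons hi hin, by rw [wordProd_cons, h.2.1, simpleRefl_mul_cancel hn hi hin], ?_⟩
  rw [List.length_cons, h.2.2, weylLength_of_descent hn hi hin hw hd]

lemma IsReducedWord.concat {L : List ℕ} (hn : 4 ≤ n) (hi : 1 ≤ i) (hin : i ≤ n)
    (hd : 0 < rootVal n i (dom n ∘ ⇑w)) (h : IsReducedWord n w L) :
    IsReducedWord n (w * simpleRefl n i) (L ++ [i]) := by
  refine ⟨h.1.append (IsWord.nil.cons hi hin), ?_, ?_⟩
  · rw [wordProd_append, h.2.1, wordProd_cons, wordProd_nil, mul_one]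
  · rw [List.length_append, h.2.2, weylLength_mul_of_ascent hn hi hin h.gen hd, List.length_singleton]

end Words

open Classical in
/-- The value at the point `h` of
`∑ ∏ₖ (s_{i₁}^{ε₁} ⋯ s_{iₖ}^{εₖ}(α_{iₖ}))⁻¹`, the sum being over all masks of the word with
product `v`. -/
noncomputable def coef (n : ℕ) : List ℕ → Perm ℤ → (ℤ → ℝ) → ℝ
  | [], v, _ => if v = 1 then 1 else 0
  | i :: L, v, h =>
    (coef n L v h - coef n L (simpleRefl n i * v) (h ∘ ⇑(simpleRefl n i))) / rootVal n i h

section Coef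

variable {n i : ℕ} {w : Perm ℤ}

lemma coef_cons (L : List ℕ) (v : Perm ℤ) (h : ℤ → ℝ) : coef n (i :: L) v h =
    (coef n L v h - coef n L (simpleRefl n i * v) (h ∘ ⇑(simpleRefl n i))) / rootVal n i h := rfl

lemma coef_concat (hn : 4 ≤ n) (hi : 1 ≤ i) (hin : i ≤ n) {L : List ℕ} (hL : IsWord n L)
    (v : Perm ℤ) (h : ℤ → ℝ) : coef n (L ++ [i]) v h =
      (coef n L v h + coef n L (v * simpleRefl n i) h) / rootVal n i (h ∘ ⇑v) := by
  induction L generalizing v h with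
  | nil =>
    have e1 : simpleRefl n i * v = 1 ↔ v = simpleRefl n i := by
      rw [mul_eq_one_iff_inv_eq, simpleRefl_inv hn hi hin, eq_comm]
    have e2 : v * simpleRefl n i = 1 ↔ v = simpleRefl n i := by
      rw [mul_eq_one_iff_eq_inv, simpleRefl_inv hn hi hin]
    have hs : simpleRefl n i ≠ 1 := fun e => (rootFst_ne hn hi hin).1 <| by
      have := simpleRefl_rootFst hn hi hin
      rwa [e, Perm.one_apply] at this
    by_cases h1 : v = 1
    · subst h1
      simp only [List.nil_append, coef, if_true, if_neg (mt e1.1 hs.symm),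
        if_neg (mt e2.1 hs.symm), Perm.coe_one, Function.comp_id, add_zero, sub_zero]
    · by_cases h2 : v = simpleRefl n i
      · subst h2
        rw [rootVal_comp_self hn hi hin]
        simp only [List.nil_append, coef, if_neg hs, if_pos (simpleRefl_mul_self hn hi hin)]
        rw [div_neg, ← neg_div]
        simp
      · simp only [List.nil_append, coef, if_neg h1, if_neg (mt e1.1 h2), if_neg (mt e2.1 h2)]
        simp
  | cons j L ih =>
    rw [List.cons_append, coef_cons, coef_cons, coef_cons, ih hL.tail, ih hL.tail,
      Function.comp_assoc, ← Perm.coe_mul, ← mul_assoc, ← mul_assoc,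
      simpleRefl_mul_self hn hL.head.1 hL.head.2, one_mul]
    ring

lemma coef_eq_zero_of_length (hn : 4 ≤ n) {L : List ℕ} (hL : IsWord n L) {v : Perm ℤ}
    (hv : Gen n v) (h : ℤ → ℝ) (hlt : L.length < weylLength n v) : coef n L v h = 0 := by
  induction L generalizing v h with
  | nil =>
    have : v ≠ 1 := by rintro rfl; simp [weylLength_one] at hlt
    simp [coef, this]
  | cons i L ih =>
    obtain ⟨hi, hin⟩ := hL.head
    have h2 := weylLength_simpleRefl_mul_le hi hin ((gen_simpleRefl hi hin).mul hv)
    rw [simpleRefl_mul_cancel hn hi hin] at h2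
    rw [List.length_cons] at hlt
    rw [coef_cons, ih hL.tail hv _ (by omega),
      ih hL.tail ((gen_simpleRefl hi hin).mul hv) _ (by omega)]
    simp

lemma coef_commute {j : ℕ} (X : List ℕ) (v : Perm ℤ) (h : ℤ → ℝ)
    (hc : simpleRefl n i * simpleRefl n j = simpleRefl n j * simpleRefl n i)
    (h1 : rootVal n j (h ∘ ⇑(simpleRefl n i)) = rootVal n j h)
    (h2 : rootVal n i (h ∘ ⇑(simpleRefl n j)) = rootVal n i h) :
    coef n (i :: j :: X) v h = coef n (j :: i :: X) v h := by
  simp only [coef_cons, h1, h2, ← mul_assoc, hc, Function.comp_assoc, ← Perm.coe_mul]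
  ring

lemma coef_braid (hn : 4 ≤ n) {j : ℕ} (hi : 1 ≤ i) (hin : i ≤ n) (hj : 1 ≤ j) (hjn : j ≤ n)
    (X : List ℕ) (v : Perm ℤ) (h : ℤ → ℝ)
    (hc : simpleRefl n i * simpleRefl n j * simpleRefl n i =
        simpleRefl n j * simpleRefl n i * simpleRefl n j)
    (hr : ∀ h : ℤ → ℝ,
        rootVal n j (h ∘ simpleRefl n i) = rootVal n i h + rootVal n j h ∧
        rootVal n i (h ∘ simpleRefl n j) = rootVal n i h + rootVal n j h)
    (h1 : rootVal n i h ≠ 0) (h2 : rootVal n j h ≠ 0) (h3 : rootVal n i h + rootVal n j h ≠ 0) :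
    coef n (i :: j :: i :: X) v h = coef n (j :: i :: j :: X) v h := by
  have r1 (h : ℤ → ℝ) := (hr h).1
  have r2 (h : ℤ → ℝ) := (hr h).2
  have c2 (v : Perm ℤ) : simpleRefl n i * (simpleRefl n j * (simpleRefl n i * v)) =
      simpleRefl n j * (simpleRefl n i * (simpleRefl n j * v)) := by
    simpa only [mul_assoc] using congrArg (· * v) hc
  have e1 (h : ℤ → ℝ) : (h ∘ ⇑(simpleRefl n i)) ∘ ⇑(simpleRefl n i) = h := by
    rw [Function.comp_assoc, ← Perm.coe_mul, simpleRefl_mul_self hn hi hin, Perm.coe_one,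
      Function.comp_id]
  have e2 (h : ℤ → ℝ) : (h ∘ ⇑(simpleRefl n j)) ∘ ⇑(simpleRefl n j) = h := by
    rw [Function.comp_assoc, ← Perm.coe_mul, simpleRefl_mul_self hn hj hjn, Perm.coe_one,
      Function.comp_id]
  have e3 (h : ℤ → ℝ) : ((h ∘ ⇑(simpleRefl n i)) ∘ ⇑(simpleRefl n j)) ∘ ⇑(simpleRefl n i) =
      ((h ∘ ⇑(simpleRefl n j)) ∘ ⇑(simpleRefl n i)) ∘ ⇑(simpleRefl n j) := by
    simp only [Function.comp_assoc, ← Perm.coe_mul, hc]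
  have s1 := rootVal_comp_self hn hi hin
  have s2 := rootVal_comp_self hn hj hjn
  simp only [coef_cons, r1, r2, s1, s2, e1, e2, e3, c2,
    simpleRefl_mul_cancel hn hi hin, simpleRefl_mul_cancel hn hj hjn]
  generalize rootVal n i h = p at *
  generalize rootVal n j h = q at *
  have e4 : -p + (p + q) = q := by ring
  have e5 : p + q + -q = p := by ring
  simp only [e4, e5]
  have h3' : q + p ≠ 0 := by rwa [add_comm]
  field_simp
  ring

lemma rootVal_dom_mul_inv (hn : 4 ≤ n) {j : ℕ} (hj : 1 ≤ j) (hjn : j ≤ n) (w : Perm ℤ) :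
    dom n ∘ ⇑(simpleRefl n j * w)⁻¹ = (dom n ∘ ⇑w⁻¹) ∘ ⇑(simpleRefl n j) := by
  rw [mul_inv_rev, simpleRefl_inv hn hj hjn, Perm.coe_mul, Function.comp_assoc]

/-- At a regular point, `coef` does not depend on the reduced word. -/
theorem coef_eq_of_reduced (hn : 4 ≤ n) {L L' : List ℕ} (hL : IsReducedWord n w L)
    (hL' : IsReducedWord n w L') (v : Perm ℤ) {h : ℤ → ℝ} (hh : Regular 1 n h) :
    coef n L v h = coef n L' v h := by
  induction hN : L.length generalizing w L L' v h with
  | zero =>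
    have h1 := hL.2.2
    have h2 := hL'.2.2
    rw [List.length_eq_zero_iff.1 hN, List.length_eq_zero_iff.1 (by omega : L'.length = 0)]
  | succ N ih =>
    have same {i : ℕ} {K K' : List ℕ} (hK : IsReducedWord n w (i :: K))
        (hK' : IsReducedWord n w (i :: K')) : coef n (i :: K) v h = coef n (i :: K') v h := by
      have hl : K.length = N := by
        have h1 := hK.2.2
        have h2 := hL.2.2
        rw [List.length_cons] at h1
        omega
      obtain ⟨hi, hin⟩ := hK.1.head
      rw [coef_cons, coef_cons, ih (hK.tail hn).1 (hK'.tail hn).1 v hh hl,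
        ih (hK.tail hn).1 (hK'.tail hn).1 _ (hh.comp hn (gen_simpleRefl hi hin)) hl]
    obtain ⟨i, K, rfl⟩ := List.exists_cons_of_length_eq_add_one hN
    have hlen' : L'.length = N + 1 := by rw [hL'.2.2, ← hL.2.2, hN]
    obtain ⟨j, K', rfl⟩ := List.exists_cons_of_length_eq_add_one hlen'
    by_cases hij : i = j
    · subst hij
      exact same hL hL'
    have hw := hL.gen
    obtain ⟨hi, hin⟩ := hL.1.head
    obtain ⟨hj, hjn⟩ := hL'.1.head
    have hdi := (hL.tail hn).2
    have hdj := (hL'.tail hn).2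
    have hs {k : ℕ} (hk : 1 ≤ k) (hkn : k ≤ n) := gen_simpleRefl hk hkn
    have hodd := (regular_dom.comp hn (hw.inv hn)).1
    rcases simpleRefl_pair hn hi hin hj hjn hij with ⟨hc, hr⟩ | ⟨hc, hr⟩
    · obtain ⟨X, hX⟩ := ((hs hj hjn).mul ((hs hi hin).mul hw)).exists_reduced
      have hX' : IsReducedWord n (simpleRefl n i * (simpleRefl n j * w)) X := by
        rwa [← mul_assoc, hc, mul_assoc]
      have hY := (hX.cons hn hj hjn ((hs hi hin).mul hw) (by
        rwa [rootVal_dom_mul_inv hn hi hin, (hr _ hodd).1])).cons hn hi hin hw hdi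
      have hY' := (hX'.cons hn hi hin ((hs hj hjn).mul hw) (by
        rwa [rootVal_dom_mul_inv hn hj hjn, (hr _ hodd).2])).cons hn hj hjn hw hdj
      rw [same hL hY, same hL' hY', coef_commute X v h hc (hr h hh.1).1 (hr h hh.1).2]
    · obtain ⟨X, hX⟩ :=
        ((hs hi hin).mul ((hs hj hjn).mul ((hs hi hin).mul hw))).exists_reduced
      have hX' : IsReducedWord n (simpleRefl n j * (simpleRefl n i * (simpleRefl n j * w))) X := by
        rwa [← mul_assoc, ← mul_assoc, ← hc, mul_assoc, mul_assoc]
      have hY := ((hX.cons hn hi hin ((hs hj hjn).mul ((hs hi hin).mul hw)) (by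
        rw [rootVal_dom_mul_inv hn hj hjn, rootVal_dom_mul_inv hn hi hin, (hr _).2,
          rootVal_comp_self hn hi hin, (hr _).1]
        linarith)).cons hn hj hjn ((hs hi hin).mul hw) (by
        rw [rootVal_dom_mul_inv hn hi hin, (hr _).1]
        linarith)).cons hn hi hin hw hdi
      have hY' := ((hX'.cons hn hj hjn ((hs hi hin).mul ((hs hj hjn).mul hw)) (by
        rw [rootVal_dom_mul_inv hn hi hin, rootVal_dom_mul_inv hn hj hjn, (hr _).1,
          rootVal_comp_self hn hj hjn, (hr _).2]
        linarith)).cons hn hi hin ((hs hj hjn).mul hw) (by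
        rw [rootVal_dom_mul_inv hn hj hjn, (hr _).2]
        linarith)).cons hn hj hjn hw hdj
      have hne := (hh.comp hn (hs hi hin)).rootVal_ne hn hj hjn
      rw [(hr h).1] at hne
      rw [same hL hY, same hL' hY', coef_braid hn hi hin hj hjn X v h hc hr
        (hh.rootVal_ne hn hi hin) (hh.rootVal_ne hn hj hjn) hne]

end Coef

section Positivity

variable {n i : ℕ} {w v : Perm ℤ}

open Classical in
/-- The value at `dom n` of `coef`, for a reduced word of `w`, normalized by the sign of `v`. -/
noncomputable def signedCoef (n : ℕ) (w v : Perm ℤ) : ℝ :=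
  if hw : Gen n w then
    (-1) ^ weylLength n v * coef n hw.exists_reduced.choose v (dom n)
  else 0

lemma signedCoef_eq (hn : 4 ≤ n) {L : List ℕ} (hL : IsReducedWord n w L) (v : Perm ℤ) :
    signedCoef n w v = (-1) ^ weylLength n v * coef n L v (dom n) := by
  rw [signedCoef, dif_pos hL.gen,
    coef_eq_of_reduced hn hL.gen.exists_reduced.choose_spec hL v regular_dom]

lemma neg_one_pow_weylLength_mul (hn : 4 ≤ n) (hi : 1 ≤ i) (hin : i ≤ n) (hv : Gen n v) :
    (-1 : ℝ) ^ weylLength n (v * simpleRefl n i) = -(-1) ^ weylLength n v := by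
  rcases (rootVal_dom_comp_ne hn hi hin hv).lt_or_gt with h | h
  · rw [← weylLength_mul_of_descent hn hi hin hv h, pow_succ]
    ring
  · rw [weylLength_mul_of_ascent hn hi hin hv h, pow_succ]
    ring

lemma signedCoef_ascent (hn : 4 ≤ n) (hi : 1 ≤ i) (hin : i ≤ n) (hw : Gen n w) (hv : Gen n v)
    (h : 0 < rootVal n i (dom n ∘ ⇑w)) :
    rootVal n i (dom n ∘ ⇑v) * signedCoef n (w * simpleRefl n i) v =
      signedCoef n w v - signedCoef n w (v * simpleRefl n i) := by
  obtain ⟨L, hL⟩ := hw.exists_reduced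
  have := rootVal_dom_comp_ne hn hi hin hv
  rw [signedCoef_eq hn hL, signedCoef_eq hn hL, signedCoef_eq hn (hL.concat hn hi hin h),
    coef_concat hn hi hin hL.1, neg_one_pow_weylLength_mul hn hi hin hv]
  field_simp
  ring

lemma signedCoef_descent (hn : 4 ≤ n) (hi : 1 ≤ i) (hin : i ≤ n) (hw : Gen n w) (hv : Gen n v)
    (h : rootVal n i (dom n ∘ ⇑w) < 0) :
    signedCoef n w (v * simpleRefl n i) = signedCoef n w v := by
  have hs := gen_simpleRefl hi hin
  have hup : 0 < rootVal n i (dom n ∘ ⇑(w * simpleRefl n i)) := by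
    rw [rootVal_comp_mul_simpleRefl hn hi hin]
    linarith
  have h1 := signedCoef_ascent hn hi hin (hw.mul hs) hv hup
  have h2 := signedCoef_ascent hn hi hin (hw.mul hs) (hv.mul hs) hup
  rw [mul_simpleRefl_cancel hn hi hin] at h1 h2
  rw [mul_simpleRefl_cancel hn hi hin, rootVal_comp_mul_simpleRefl hn hi hin] at h2
  have := rootVal_dom_comp_ne hn hi hin hv
  refine mul_left_cancel₀ this ?_
  linarith

lemma signedCoef_eq_zero (hn : 4 ≤ n) (hw : Gen n w) (hv : Gen n v)
    (h : weylLength n w < weylLength n v) : signedCoef n w v = 0 := by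
  obtain ⟨L, hL⟩ := hw.exists_reduced
  rw [signedCoef_eq hn hL, coef_eq_zero_of_length hn hL.1 hv _ (by rwa [hL.2.2]), mul_zero]

lemma IsReducedWord.of_concat (hn : 4 ≤ n) {L : List ℕ} (h : IsReducedWord n w (L ++ [i])) :
    IsReducedWord n (w * simpleRefl n i) L ∧ rootVal n i (dom n ∘ ⇑w) < 0 := by
  obtain ⟨hi, hin⟩ := h.1 i (by simp)
  have hw := h.gen
  obtain ⟨h1, rfl, h3⟩ := h
  have hL : IsWord n L := fun j hj => h1 j (by simp [hj])
  have e : wordProd n L = wordProd n (L ++ [i]) * simpleRefl n i := by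
    rw [wordProd_append, wordProd_cons, wordProd_nil, mul_one, mul_simpleRefl_cancel hn hi hin]
  have hle := weylLength_wordProd_le hL
  rw [e] at hle
  rw [List.length_append, List.length_singleton] at h3
  rcases (rootVal_dom_comp_ne hn hi hin hw).lt_or_gt with h | h
  · have := weylLength_mul_of_descent hn hi hin hw h
    exact ⟨⟨hL, e, by omega⟩, h⟩
  · have := weylLength_mul_of_ascent hn hi hin hw h
    omega

lemma signedCoef_self_pos (hn : 4 ≤ n) (hw : Gen n w) : 0 < signedCoef n w w := by
  obtain ⟨L, hL⟩ := hw.exists_reduced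
  clear hw
  induction L using List.reverseRecOn generalizing w with
  | nil =>
    obtain rfl : w = 1 := by rw [← hL.2.1, wordProd_nil]
    rw [signedCoef_eq hn hL]
    simp [weylLength_one, coef]
  | append_singleton L i ih =>
    obtain ⟨hi, hin⟩ := hL.1 i (by simp)
    obtain ⟨hL', hd⟩ := hL.of_concat hn
    have hup : 0 < rootVal n i (dom n ∘ ⇑(w * simpleRefl n i)) := by
      rw [rootVal_comp_mul_simpleRefl hn hi hin]
      linarith
    have h1 := signedCoef_ascent hn hi hin hL'.gen hL.gen hup
    rw [mul_simpleRefl_cancel hn hi hin, signedCoef_eq_zero hn hL'.gen hL.gen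
      (by have := weylLength_mul_of_descent hn hi hin hL.gen hd; omega)] at h1
    have := ih hL'
    nlinarith

lemma exists_weylLength_le (hn : 4 ≤ n) : ∃ B, ∀ w, Gen n w → weylLength n w ≤ B := by
  have hidx (w : {w // Gen n w}) (x : Set.Icc (-(n : ℤ)) n) : w.1 x.1 ∈ Set.Icc (-(n : ℤ)) n := by
    obtain ⟨x, h1, h2⟩ := x
    change -(n : ℤ) ≤ w.1 x ∧ w.1 x ≤ n
    by_cases hx : Idx 1 n x
    · have := w.2.idx hn hx
      unfold Idx at this
      omega
    · rw [w.2.apply_of_not_idx hn hx]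
      exact ⟨h1, h2⟩
  have : Finite {w // Gen n w} := by
    refine Finite.of_injective
      (fun w => fun x : Set.Icc (-(n : ℤ)) n => (⟨w.1 x.1, hidx w x⟩ : Set.Icc (-(n : ℤ)) n)) ?_
    intro w w' e
    ext x
    by_cases hx : Idx 1 n x
    · have hx' : x ∈ Set.Icc (-(n : ℤ)) n := by
        unfold Idx at hx
        rw [Set.mem_Icc]
        omega
      exact congrArg Subtype.val (congrFun e ⟨x, hx'⟩)
    · rw [w.2.apply_of_not_idx hn hx, w'.2.apply_of_not_idx hn hx]
  obtain ⟨B, hB⟩ := (Set.finite_range fun w : {w // Gen n w} => weylLength n w.1).bddAbove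
  exact ⟨B, fun w hw => hB ⟨⟨w, hw⟩, rfl⟩⟩

/-- If `w` has no ascent then `signedCoef n w` is a positive constant. -/
lemma signedCoef_of_no_ascent (hn : 4 ≤ n) (hw : Gen n w)
    (ht : ∀ i, 1 ≤ i → i ≤ n → rootVal n i (dom n ∘ ⇑w) < 0) (hv : Gen n v) :
    signedCoef n w v = signedCoef n w w := by
  have key (u : Perm ℤ) (hu : Gen n u) (L : List ℕ) (hL : IsWord n L) :
      signedCoef n w (u * wordProd n L) = signedCoef n w u := by
    induction L generalizing u with
    | nil => rw [wordProd_nil, mul_one]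
    | cons i L ih =>
      obtain ⟨hi, hin⟩ := hL.head
      rw [wordProd_cons, ← mul_assoc, ih _ (hu.mul (gen_simpleRefl hi hin)) hL.tail,
        signedCoef_descent hn hi hin hw hu (ht i hi hin)]
  obtain ⟨L, hL, e⟩ := (hw.inv hn).mul hv
  rw [← key w hw L hL, e, mul_inv_cancel_left]

theorem signedCoef_nonneg (hn : 4 ≤ n) (hw : Gen n w) :
    (∀ v, Gen n v → 0 ≤ signedCoef n w v) ∧ 0 < signedCoef n w 1 := by
  obtain ⟨B, hB⟩ := exists_weylLength_le hn
  induction hN : B - weylLength n w using Nat.strong_induction_on generalizing w with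
  | h N ih =>
  by_cases ht : ∀ i, 1 ≤ i → i ≤ n → rootVal n i (dom n ∘ ⇑w) < 0
  · have hpos := signedCoef_self_pos hn hw
    refine ⟨fun v hv => ?_, ?_⟩
    · rw [signedCoef_of_no_ascent hn hw ht hv]
      exact hpos.le
    · rwa [signedCoef_of_no_ascent hn hw ht Gen.one]
  have asc {u : Perm ℤ} (hu : Gen n u)
      (ht : ¬ ∀ i, 1 ≤ i → i ≤ n → rootVal n i (dom n ∘ ⇑u) < 0) :
      ∃ i, 1 ≤ i ∧ i ≤ n ∧ 0 < rootVal n i (dom n ∘ ⇑u) := by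
    push Not at ht
    obtain ⟨i, hi, hin, h⟩ := ht
    exact ⟨i, hi, hin, lt_of_le_of_ne h (rootVal_dom_comp_ne hn hi hin hu).symm⟩
  have ih' {i : ℕ} (hi : 1 ≤ i) (hin : i ≤ n) (h : 0 < rootVal n i (dom n ∘ ⇑w)) :
      (∀ v, Gen n v → 0 ≤ signedCoef n (w * simpleRefl n i) v) ∧
        0 < signedCoef n (w * simpleRefl n i) 1 := by
    have hg := hw.mul (gen_simpleRefl hi hin)
    have h1 := weylLength_mul_of_ascent hn hi hin hw h
    have h2 := hB _ hg
    exact ih _ (by omega) hg rfl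
  obtain ⟨k, hk, hkn, hka⟩ := asc hw ht
  have nonneg (v : Perm ℤ) (hv : Gen n v) : 0 ≤ signedCoef n w v := by
    induction hM : B - weylLength n v using Nat.strong_induction_on generalizing v with
    | h M ihv =>
    by_cases hvt : ∀ i, 1 ≤ i → i ≤ n → rootVal n i (dom n ∘ ⇑v) < 0
    · have hg := hw.mul (gen_simpleRefl hk hkn)
      refine (signedCoef_eq_zero hn hw hv ?_).ge
      by_contra hle
      have hp := signedCoef_self_pos hn hv
      rw [← signedCoef_of_no_ascent hn hv hvt hg, signedCoef_eq_zero hn hv hg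
        (by rw [weylLength_mul_of_ascent hn hk hkn hw hka]; omega)] at hp
      exact lt_irrefl _ hp
    · obtain ⟨i, hi, hin, ha⟩ := asc hv hvt
      have hg := hv.mul (gen_simpleRefl hi hin)
      have h1 := weylLength_mul_of_ascent hn hi hin hv ha
      have h2 := hB _ hg
      have h3 := ihv _ (by omega) _ hg rfl
      rcases (rootVal_dom_comp_ne hn hi hin hw).lt_or_gt with h | h
      · rwa [signedCoef_descent hn hi hin hw hv h] at h3
      · have h4 := signedCoef_ascent hn hi hin hw hv h
        have h5 := mul_nonneg ha.le ((ih' hi hin h).1 v hv)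
        linarith
  refine ⟨nonneg, ?_⟩
  have h4 := signedCoef_ascent hn hk hkn hw Gen.one hka
  have h5 := nonneg _ (Gen.one.mul (gen_simpleRefl hk hkn))
  have h6 : rootVal n k (dom n ∘ ⇑(1 : Perm ℤ)) = 1 := by
    simp [rootVal, dom, height_rootFst hn hk]
  rw [h6] at h4
  have := (ih' hk hkn hka).2
  linarith

/-- The identity coefficient is positive at the dominant point. -/
theorem coef_one_pos (hn : 4 ≤ n) {L : List ℕ} (hL : IsReducedWord n w L) :
    0 < coef n L 1 (dom n) := by
  simpa [signedCoef_eq hn hL, weylLength_one] using (signedCoef_nonneg hn hL.gen).2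

end Positivity

/-- `HeightPath n M k`: the word `M` in the letters `2, …, n` takes `2` to `k`, each letter lowering the
height by one. -/
inductive HeightPath (n : ℕ) : List ℕ → ℤ → Prop
  | nil : HeightPath n [] 2
  | cons {i : ℕ} {M : List ℕ} {k : ℤ} (hi : 2 ≤ i) (hin : i ≤ n)
      (hk : height n (simpleRefl n i k) = height n k + 1) (h : HeightPath n M (simpleRefl n i k)) :
      HeightPath n (i :: M) k

section Factorization

variable {n : ℕ} {w : Perm ℤ} {M : List ℕ} {k : ℤ}

lemma HeightPath.letters (h : HeightPath n M k) : ∀ i ∈ M, 2 ≤ i ∧ i ≤ n := by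
  induction h with
  | nil => simp
  | cons hi hin _ _ ih =>
    intro j hj
    rcases List.mem_cons.1 hj with rfl | hj
    · exact ⟨hi, hin⟩
    · exact ih j hj

lemma HeightPath.isWord (h : HeightPath n M k) : IsWord n M := fun i hi => by
  have := h.letters i hi
  omega

lemma HeightPath.wordProd_two (hn : 4 ≤ n) (h : HeightPath n M k) : wordProd n M 2 = k := by
  induction h with
  | nil => simp [wordProd_nil]
  | cons hi hin _ _ ih =>
    rw [wordProd_cons, Perm.mul_apply, ih, simpleRefl_simpleRefl hn (by omega) hin]

lemma HeightPath.idx (hn : 4 ≤ n) (h : HeightPath n M k) : Idx 2 n k := by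
  induction h with
  | nil => unfold Idx; omega
  | @cons i M k hi hin _ _ ih =>
    have := simpleRefl_idx_two hn hi hin ih
    rwa [simpleRefl_simpleRefl hn (by omega) hin] at this

lemma exists_path (hn : 4 ≤ n) (hk : Idx 2 n k) : ∃ M, HeightPath n M k := by
  induction hN : ((n : ℤ) - 2 - height n k).toNat generalizing k with
  | zero =>
    obtain rfl : k = 2 := by
      unfold height at hN; unfold Idx at hk; split_ifs at hN <;> omega
    exact ⟨[], HeightPath.nil⟩
  | succ N ih =>
    obtain ⟨i, hi, hin, hik⟩ :
        ∃ i, 2 ≤ i ∧ i ≤ n ∧ height n (simpleRefl n i k) = height n k + 1 := by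
      have hk2 : k ≠ 2 := by
        rintro rfl
        simp [height] at hN
      unfold Idx at hk
      by_cases hpos : 0 < k
      · refine ⟨(k - 1).toNat, by omega, by omega, ?_⟩
        rw [simpleRefl_apply_of_lt (by omega) (by omega)]
        unfold height
        split_ifs <;> omega
      by_cases hkn : k = -n
      · refine ⟨n, by omega, le_rfl, ?_⟩
        rw [simpleRefl_apply_last hn]
        unfold height
        split_ifs <;> omega
      · refine ⟨(-k).toNat, by omega, by omega, ?_⟩
        rw [simpleRefl_apply_of_lt (by omega) (by omega)]
        unfold height
        split_ifs <;> omega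
    obtain ⟨M, hM⟩ := ih (simpleRefl_idx_two hn hi hin hk) (by omega)
    exact ⟨i :: M, HeightPath.cons hi hin hik hM⟩

lemma wordProd_apply_one (hn : 4 ≤ n) (hM : ∀ i ∈ M, 2 ≤ i ∧ i ≤ n) : wordProd n M 1 = 1 := by
  induction M with
  | nil => simp [wordProd_nil]
  | cons i M ih =>
    obtain ⟨hi, hin⟩ := hM i (by simp)
    rw [wordProd_cons, Perm.mul_apply, ih fun j hj => hM j (by simp [hj]),
      simpleRefl_one_of_two_le hn hi hin]

/-- If `w⁻¹` attains at `k` its greatest height among the indices `±2, …, ±n`, then a path to `k`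
can be split off from the left of a reduced word of `w`. -/
lemma HeightPath.isReducedWord_append (hn : 4 ≤ n) (h : HeightPath n M k) (hw : Gen n w)
    (hmax : ∀ k', Idx 2 n k' → k' ≠ k → height n (w⁻¹ k') < height n (w⁻¹ k)) {Z : List ℕ}
    (hZ : IsReducedWord n ((wordProd n M)⁻¹ * w) Z) : IsReducedWord n w (M ++ Z) := by
  induction h generalizing w with
  | nil => simpa [wordProd_nil] using hZ
  | @cons i M k hi hin hk hM ih =>
    have hi1 : 1 ≤ i := by omega
    refine IsReducedWord.cons hn hi1 hin hw ?_ (ih ((gen_simpleRefl hi1 hin).mul hw) ?_ ?_)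
    · have hwn := (hw.inv hn).map_neg hn
      have hlt : height n (w⁻¹ (rootFst n i)) < height n (w⁻¹ (rootSnd n i)) := by
        have hne := (rootFst_ne hn hi1 hin).1
        rcases height_simpleRefl_cases hn hi1 hin k with ⟨-, e⟩ | ⟨rfl | rfl, -⟩ | e
        · omega
        · exact hmax _ (rootFst_idx_two hn hi) hne
        · have := hmax _ (rootSnd_idx_two hn hi).neg (fun e => hne (neg_injective e).symm)
          rw [hwn, hwn, height_neg, height_neg] at this
          omega
        · omega
      simp only [rootVal, dom, Function.comp]
      exact sub_neg.2 (by exact_mod_cast hlt)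
    · intro k' hk' hne
      simp only [mul_inv_rev, simpleRefl_inv hn hi1 hin, Perm.mul_apply,
        simpleRefl_simpleRefl hn hi1 hin]
      refine hmax _ (simpleRefl_idx_two hn hi hin hk') fun e => hne ?_
      rw [← e, simpleRefl_simpleRefl hn hi1 hin]
    · rwa [wordProd_cons, mul_inv_rev, simpleRefl_inv hn hi1 hin, mul_assoc] at hZ

lemma IsReducedWord.reverse (hn : 4 ≤ n) {L : List ℕ} (h : IsReducedWord n w L) :
    IsReducedWord n w⁻¹ L.reverse := by
  refine ⟨h.1.reverse, by rw [wordProd_reverse hn h.1, h.2.1], ?_⟩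
  rw [List.length_reverse, h.2.2, weylLength_inv hn h.gen]

lemma IsReducedWord.three_le (hn : 4 ≤ n) {Y : List ℕ} (hY : IsReducedWord n w Y) (h1 : w 1 = 1)
    (h2 : w 2 = 2) : ∀ i ∈ Y, 3 ≤ i := by
  induction Y generalizing w with
  | nil => simp
  | cons i Y ih =>
    obtain ⟨hi, hin⟩ := hY.1.head
    obtain ⟨ht, hd⟩ := hY.tail hn
    have h1' : w⁻¹ 1 = 1 := by rw [Perm.inv_eq_iff_eq, h1]
    have h2' : w⁻¹ 2 = 2 := by rw [Perm.inv_eq_iff_eq, h2]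
    have hd' : height n (w⁻¹ (rootFst n i)) < height n (w⁻¹ (rootSnd n i)) := by
      simp only [rootVal, dom, Function.comp] at hd
      exact_mod_cast sub_neg.1 hd
    have hi3 : 3 ≤ i := by
      by_contra hlt
      have hi' : i = 1 ∨ i = 2 := by omega
      have hin' : i < n := by omega
      have e : rootFst n i = i ∧ rootSnd n i = i + 1 := by simp [rootFst, rootSnd, hin']
      rw [e.1, e.2] at hd'
      rcases hi' with rfl | rfl
      · rw [Nat.cast_one, one_add_one_eq_two, h1', h2'] at hd'
        simp [height] at hd'
      · rw [Nat.cast_two, two_add_one_eq_three, h2'] at hd'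
        have hne : w⁻¹ 3 ≠ 1 := fun e => by
          rw [← h1'] at e
          exact absurd (w⁻¹.injective e) (by norm_num)
        have hx := (hY.gen.inv hn).idx hn (show Idx 1 n 3 by unfold Idx; omega)
        unfold Idx at hx
        unfold height at hd'
        split_ifs at hd' <;> omega
    intro j hj
    rcases List.mem_cons.1 hj with rfl | hj
    · exact hi3
    · refine ih ht ?_ ?_ j hj
      · rw [Perm.mul_apply, h1, simpleRefl_one_of_two_le hn (by omega) hin]
      · rw [Perm.mul_apply, h2, simpleRefl_two_of_three_le hn hi3 hin]

/-- The reduced word `M · s₁ · Y · M⁻¹` of an involution moving `1` to `k = M(2)`, the letters of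
`Y` being at least `3`. -/
theorem HeightPath.exists_reduced (hn : 4 ≤ n) (h : HeightPath n M k) (hw : Gen n w) (h1 : w 1 = k)
    (hk : w k = 1) : ∃ y Y, IsReducedWord n y Y ∧ (∀ i ∈ Y, 3 ≤ i) ∧
      IsReducedWord n w (M ++ 1 :: (Y ++ M.reverse)) := by
  set g := wordProd n M with hg
  have hg1 : g 1 = 1 := wordProd_apply_one hn h.letters
  have hg2 : g 2 = k := h.wordProd_two hn
  have hgG : Gen n g := gen_wordProd h.isWord
  have hkI := h.idx hn
  have e12 : simpleRefl n 1 1 = 2 := by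
    rw [simpleRefl_apply_of_lt le_rfl (by omega)]; simp
  have e21 : simpleRefl n 1 2 = 1 := by
    rw [simpleRefl_apply_of_lt le_rfl (by omega)]; simp
  have hs := gen_simpleRefl (n := n) le_rfl (by omega : 1 ≤ n)
  have hk' : w⁻¹ k = 1 := by rw [Perm.inv_eq_iff_eq, h1]
  have h1' : w⁻¹ 1 = k := by rw [Perm.inv_eq_iff_eq, hk]
  have hg1' : g⁻¹ 1 = 1 := by rw [Perm.inv_eq_iff_eq, hg1]
  have hg2' : g⁻¹ k = 2 := by rw [Perm.inv_eq_iff_eq, hg2]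
  set u := simpleRefl n 1 * (g⁻¹ * w) with hu
  have huG : Gen n u := hs.mul ((hgG.inv hn).mul hw)
  have hu1 : u 1 = 1 := by simp only [hu, Perm.mul_apply, h1, hg2', e21]
  have huk : u k = 2 := by simp only [hu, Perm.mul_apply, hk, hg1', e12]
  obtain ⟨Y, hY⟩ := (huG.mul hgG).exists_reduced
  refine ⟨u * g, Y, hY, hY.three_le hn ?_ ?_, ?_⟩
  · rw [Perm.mul_apply, hg1, hu1]
  · rw [Perm.mul_apply, hg2, huk]
  refine h.isReducedWord_append hn hw (fun k' hk2 hne => ?_) ?_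
  · have hne' : w⁻¹ k' ≠ 1 := fun e => hne (w⁻¹.injective (by rw [e, hk']))
    have := (hw.inv hn).idx hn (hk2.mono (by norm_num : (1 : ℤ) ≤ 2))
    rw [hk']
    unfold height
    unfold Idx at this
    split_ifs <;> omega
  refine IsReducedWord.cons hn le_rfl (by omega) ((hgG.inv hn).mul hw) ?_ ?_
  · have hlt : height n ((g⁻¹ * w)⁻¹ (rootFst n 1)) < height n ((g⁻¹ * w)⁻¹ (rootSnd n 1)) := by
      have hn1 : 1 < n := by omega
      have e : rootFst n 1 = 1 ∧ rootSnd n 1 = 2 := by simp [rootFst, rootSnd, hn1]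
      rw [e.1, e.2, mul_inv_rev, inv_inv, Perm.mul_apply, Perm.mul_apply, hg1, hg2, hk', h1']
      unfold height
      unfold Idx at hkI
      split_ifs <;> omega
    simp only [rootVal, dom, Function.comp]
    exact sub_neg.2 (by exact_mod_cast hlt)
  · have hr : IsReducedWord n u⁻¹ (M ++ Y.reverse) := by
      refine h.isReducedWord_append hn (huG.inv hn) (fun k' hk2 hne => ?_) ?_
      · have hne1 : u k' ≠ 2 := fun e => hne (u.injective (by rw [e, huk]))
        have hne2 : u k' ≠ 1 := fun e => by
          have := u.injective (e.trans hu1.symm)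
          unfold Idx at hk2
          omega
        have := huG.idx hn (hk2.mono (by norm_num : (1 : ℤ) ≤ 2))
        rw [inv_inv, huk]
        unfold height
        unfold Idx at this
        split_ifs <;> omega
      · simpa [mul_inv_rev] using hY.reverse hn
    simpa using hr.reverse hn

end Factorization

/-- The point `h` with its first coordinate replaced by `t`. -/
noncomputable def updOne (h : ℤ → ℝ) (t : ℝ) (k : ℤ) : ℝ :=
  if k = 1 then t else if k = -1 then -t else h k

/-- The limit of `(t - q) * coef n (M ++ 1 :: Z) v (updOne h t)` as `t` tends to `q`. -/
noncomputable def residue (n : ℕ) (q : ℝ) (Z : List ℕ) : List ℕ → Perm ℤ → (ℤ → ℝ) → ℝ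
  | [], v, h => if h 2 = q then coef n Z v h else 0
  | i :: M, v, h => (residue n q Z M v h -
      residue n q Z M (simpleRefl n i * v) (h ∘ ⇑(simpleRefl n i))) / rootVal n i h

section Residue

open Filter Topology

variable {n i : ℕ} {M Y Z : List ℕ} {k : ℤ} {v : Perm ℤ} {h : ℤ → ℝ} {q : ℝ}

lemma updOne_of_idx {t : ℝ} (hk : Idx 2 n k) : updOne h t k = h k := by
  unfold Idx at hk
  rw [updOne, if_neg (by omega), if_neg (by omega)]

lemma updOne_comp (hn : 4 ≤ n) {g : Perm ℤ} (hg : Gen n g) (hg1 : g 1 = 1) (t : ℝ) :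
    updOne h t ∘ ⇑g = updOne (h ∘ ⇑g) t := by
  have hg1' : g (-1) = -1 := by rw [hg.map_neg hn, hg1]
  have e1 (k : ℤ) : g k = 1 ↔ k = 1 := by rw [← hg1, g.injective.eq_iff, hg1]
  have e2 (k : ℤ) : g k = -1 ↔ k = -1 := by rw [← hg1', g.injective.eq_iff, hg1']
  funext k
  simp only [Function.comp, updOne, e1, e2]

lemma rootVal_updOne (hn : 4 ≤ n) (hi : 2 ≤ i) (t : ℝ) :
    rootVal n i (updOne h t) = rootVal n i h := by
  rw [rootVal, updOne_of_idx (rootFst_idx_two hn hi), updOne_of_idx (rootSnd_idx_two hn hi),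
    rootVal]

lemma updOne_comp_simpleRefl (hn : 4 ≤ n) (hi : 2 ≤ i) (hin : i ≤ n) (t : ℝ) :
    updOne h t ∘ ⇑(simpleRefl n i) = updOne (h ∘ ⇑(simpleRefl n i)) t :=
  updOne_comp hn (gen_simpleRefl (by omega) hin) (simpleRefl_one_of_two_le hn hi hin) t

lemma coef_updOne (hn : 4 ≤ n) (hZ : ∀ i ∈ Z, 2 ≤ i ∧ i ≤ n) (t : ℝ) :
    coef n Z v (updOne h t) = coef n Z v h := by
  induction Z generalizing v h with
  | nil => rfl
  | cons i Z ih =>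
    obtain ⟨hi, hin⟩ := hZ i (by simp)
    have hZ' := fun j hj => hZ j (List.mem_cons_of_mem i hj)
    rw [coef_cons, coef_cons, ih hZ', updOne_comp_simpleRefl hn hi hin, ih hZ',
      rootVal_updOne hn hi]

/-- Words whose letters fix the index `a` only reach elements fixing `a`. -/
lemma coef_eq_zero_of_apply_ne {a : ℤ} (hZ : ∀ i ∈ Z, simpleRefl n i a = a) (hv : v a ≠ a) :
    coef n Z v h = 0 := by
  induction Z generalizing v h with
  | nil =>
    have : v ≠ 1 := by rintro rfl; exact hv rfl
    simp [coef, this]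
  | cons i Z ih =>
    have hi := hZ i (by simp)
    have hZ' := fun j hj => hZ j (List.mem_cons_of_mem i hj)
    rw [coef_cons, ih hZ' hv, ih hZ' fun e => hv ?_]
    · simp
    · rw [Perm.mul_apply] at e
      exact (simpleRefl n i).injective (e.trans hi.symm)

lemma tendsto_residue (hn : 4 ≤ n) (hZ : ∀ i ∈ Z, 2 ≤ i ∧ i ≤ n) (hM : ∀ i ∈ M, 2 ≤ i ∧ i ≤ n)
    (hv : v 1 = 1) :
    Tendsto (fun t => (t - q) * coef n (M ++ 1 :: Z) v (updOne h t)) (𝓝[≠] q)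
      (𝓝 (residue n q Z M v h)) := by
  induction M generalizing v h with
  | nil =>
    have hn1 : 1 < n := by omega
    have e (t : ℝ) : coef n (1 :: Z) v (updOne h t) = coef n Z v h / (t - h 2) := by
      have hr : rootVal n 1 (updOne h t) = t - h 2 := by
        simp [rootVal, rootFst, rootSnd, hn1, updOne]
      rw [coef_cons, hr, coef_updOne hn hZ, coef_eq_zero_of_apply_ne (a := 1) (v := _ * v), sub_zero]
      · exact fun i hi => simpleRefl_one_of_two_le hn (hZ i hi).1 (hZ i hi).2
      · rw [Perm.mul_apply, hv, simpleRefl_apply_of_lt le_rfl hn1]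
        simp
    simp only [List.nil_append, e, residue]
    split_ifs with hq
    · refine tendsto_const_nhds.congr' ?_
      filter_upwards [self_mem_nhdsWithin] with t ht
      have : t - q ≠ 0 := sub_ne_zero.2 ht
      rw [hq]
      field_simp
    · have hc : ContinuousAt (fun t => (t - q) * (coef n Z v h / (t - h 2))) q := by
        have : q - h 2 ≠ 0 := sub_ne_zero.2 (Ne.symm hq)
        fun_prop (disch := assumption)
      have := hc.tendsto
      simp only [sub_self, zero_mul] at this
      exact this.mono_left nhdsWithin_le_nhds
  | cons i M ih =>
    obtain ⟨hi, hin⟩ := hM i (by simp)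
    have hM' := fun j hj => hM j (List.mem_cons_of_mem i hj)
    have h1 := ih (v := v) (h := h) hM' hv
    have h2 := ih (v := simpleRefl n i * v) (h := h ∘ ⇑(simpleRefl n i)) hM'
      (by rw [Perm.mul_apply, hv, simpleRefl_one_of_two_le hn hi hin])
    refine ((h1.sub h2).div_const (rootVal n i h)).congr fun t => ?_
    rw [List.cons_append, coef_cons, rootVal_updOne hn hi, updOne_comp_simpleRefl hn hi hin]
    ring

lemma HeightPath.residue_eq_zero (hn : 4 ≤ n) (hM : HeightPath n M k)
    (hq : ∀ m, Idx 2 n m → height n k ≤ height n m → h m ≠ q) : residue n q Z M v h = 0 := by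
  induction hM generalizing v h with
  | nil => rw [residue, if_neg (hq 2 (by unfold Idx; omega) le_rfl)]
  | cons hi hin hk hM ih =>
    rw [residue, ih fun m hm hle => hq m hm (by omega), ih fun m hm hle => ?_]
    · simp
    · have := height_simpleRefl hn (by omega) hin m
      exact hq _ (simpleRefl_idx_two hn hi hin hm) (by omega)

lemma Regular.comp_simpleRefl_two (hn : 4 ≤ n) (hi : 2 ≤ i) (hin : i ≤ n) (hh : Regular 2 n h) :
    Regular 2 n (h ∘ ⇑(simpleRefl n i)) := by
  have hs := simpleRefl_neg hn (by omega : 1 ≤ i) hin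
  refine ⟨fun k => by simp [hs, hh.1], fun a b ha hb hab hab' => ?_⟩
  refine hh.2 _ _ (simpleRefl_idx_two hn hi hin ha) (simpleRefl_idx_two hn hi hin hb)
    (fun e => hab ((simpleRefl n i).injective e)) fun e => hab' ?_
  rw [← hs] at e
  exact (simpleRefl n i).injective e

lemma HeightPath.exists_residue_eq (hn : 4 ≤ n) (hM : HeightPath n M k) (hh : Regular 2 n h)
    (hq : ∀ m, Idx 2 n m → (h m = q ↔ m = k)) :
    ∃ c ≠ 0, residue n q Z M v h = c * coef n Z ((wordProd n M)⁻¹ * v) (h ∘ ⇑(wordProd n M)) := by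
  induction hM generalizing v h with
  | nil =>
    refine ⟨1, one_ne_zero, ?_⟩
    rw [residue, if_pos ((hq 2 (by unfold Idx; omega)).2 rfl), wordProd_nil]
    simp
  | @cons i M k hi hin hk hM ih =>
    have hi1 : 1 ≤ i := by omega
    obtain ⟨c, hc, e⟩ := ih (v := simpleRefl n i * v) (hh.comp_simpleRefl_two hn hi hin)
      fun m hm => by
        rw [Function.comp, hq _ (simpleRefl_idx_two hn hi hin hm)]
        constructor
        · rintro rfl
          rw [simpleRefl_simpleRefl hn hi1 hin]
        · rintro rfl
          rw [simpleRefl_simpleRefl hn hi1 hin]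
    have hr : rootVal n i h ≠ 0 := sub_ne_zero.2 (hh.2 _ _ (rootFst_idx_two hn hi)
      (rootSnd_idx_two hn hi) (rootFst_ne hn hi1 hin).1 (rootFst_ne hn hi1 hin).2)
    refine ⟨-c / rootVal n i h, div_ne_zero (neg_ne_zero.2 hc) hr, ?_⟩
    rw [residue, hM.residue_eq_zero hn fun m hm hle => ?_, e, wordProd_cons, mul_inv_rev,
      simpleRefl_inv hn hi1 hin, mul_assoc, Perm.coe_mul, Function.comp_assoc]
    · ring
    · rw [Ne, hq m hm]
      rintro rfl
      omega

lemma HeightPath.coef_append_reverse_eq_zero (hn : 4 ≤ n) (hM : HeightPath n M k)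
    (hY : ∀ i ∈ Y, 3 ≤ i ∧ i ≤ n) (hv : height n (v⁻¹ 2) < height n k) :
    coef n (Y ++ M.reverse) v h = 0 := by
  induction hM generalizing v with
  | nil =>
    rw [List.reverse_nil, List.append_nil]
    refine coef_eq_zero_of_apply_ne (a := 2)
      (fun i hi => simpleRefl_two_of_three_le hn (hY i hi).1 (hY i hi).2) fun e => ?_
    rw [Perm.inv_eq_iff_eq.2 e.symm] at hv
    exact lt_irrefl _ hv
  | @cons i M k hi hin hk hM ih =>
    have hi1 : 1 ≤ i := by omega
    have hW : IsWord n (Y ++ M.reverse) :=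
      IsWord.append (fun i hi => by have := hY i hi; omega) hM.isWord.reverse
    have := height_simpleRefl hn hi1 hin (simpleRefl n i (v⁻¹ 2))
    rw [simpleRefl_simpleRefl hn hi1 hin] at this
    rw [List.reverse_cons, ← List.append_assoc, coef_concat hn hi1 hin hW, ih (by omega), ih]
    · simp
    · rw [mul_inv_rev, simpleRefl_inv hn hi1 hin, Perm.mul_apply]
      omega

lemma HeightPath.exists_coef_append_reverse_eq (hn : 4 ≤ n) (hM : HeightPath n M k)
    (hY : ∀ i ∈ Y, 3 ≤ i ∧ i ≤ n) :
    ∃ c ≠ 0, coef n (Y ++ M.reverse) (wordProd n M)⁻¹ (dom n) = c * coef n Y 1 (dom n) := by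
  induction hM with
  | nil => exact ⟨1, one_ne_zero, by simp [wordProd_nil]⟩
  | @cons i M k hi hin hk hM ih =>
    have hi1 : 1 ≤ i := by omega
    have hW : IsWord n (Y ++ M.reverse) :=
      IsWord.append (fun i hi => by have := hY i hi; omega) hM.isWord.reverse
    obtain ⟨c, hc, e⟩ := ih
    have hr := rootVal_dom_comp_ne hn hi1 hin
      (((gen_wordProd hM.isWord).inv hn).mul (gen_simpleRefl hi1 hin))
    refine ⟨c / _, div_ne_zero hc hr, ?_⟩
    rw [List.reverse_cons, ← List.append_assoc, coef_concat hn hi1 hin hW, wordProd_cons,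
      mul_inv_rev, simpleRefl_inv hn hi1 hin, mul_simpleRefl_cancel hn hi1 hin, e,
      hM.coef_append_reverse_eq_zero hn hY, zero_add]
    · ring
    · rw [mul_inv_rev, inv_inv, simpleRefl_inv hn hi1 hin, Perm.mul_apply, hM.wordProd_two hn,
        simpleRefl_simpleRefl hn hi1 hin]
      omega

lemma dom_apply_of_idx_two (hn : 4 ≤ n) {u : Perm ℤ} (hu : Gen n u) (h1 : u 1 = 1) {m : ℤ}
    (hm : Idx 2 n m) : dom n (u m) ≤ n - 2 ∧ (dom n (u m) = n - 2 ↔ u m = 2) := by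
  have hx := hu.idx hn (hm.mono (by norm_num : (1 : ℤ) ≤ 2))
  have hne : u m ≠ 1 := fun e => by
    have := u.injective (e.trans h1.symm)
    unfold Idx at hm
    omega
  have key : height n (u m) ≤ n - 2 ∧ (height n (u m) = n - 2 ↔ u m = 2) := by
    unfold height
    unfold Idx at hx
    split_ifs <;> omega
  refine ⟨?_, ?_⟩
  · have : (height n (u m) : ℝ) ≤ ((n - 2 : ℤ) : ℝ) := Int.cast_le.2 key.1
    simpa [dom] using this
  · rw [← key.2, dom]
    norm_cast

/-- The identity coefficient of the reduced word `M · s₁ · Y · M⁻¹` has a simple pole along the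
root joining `1` and `k`. -/
theorem HeightPath.exists_tendsto (hn : 4 ≤ n) (hM : HeightPath n M k) {y : Perm ℤ}
    (hy : IsReducedWord n y Y) (hY : ∀ i ∈ Y, 3 ≤ i) :
    ∃ A ≠ 0, Tendsto (fun t => (t - (n - 2)) * coef n (M ++ 1 :: (Y ++ M.reverse)) 1
      (updOne (dom n ∘ ⇑(wordProd n M)⁻¹) t)) (𝓝[≠] (n - 2)) (𝓝 A) := by
  have hY' : ∀ i ∈ Y, 3 ≤ i ∧ i ≤ n := fun i hi => ⟨hY i hi, (hy.1 i hi).2⟩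
  have hZ : ∀ i ∈ Y ++ M.reverse, 2 ≤ i ∧ i ≤ n := fun i hi => by
    rcases List.mem_append.1 hi with h | h
    · have := hY' i h
      omega
    · exact hM.letters i (List.mem_reverse.1 h)
  have hg := (gen_wordProd hM.isWord).inv hn
  have hreg := regular_dom.comp hn hg
  have hreg2 : Regular 2 n (dom n ∘ ⇑(wordProd n M)⁻¹) :=
    ⟨hreg.1, fun a b ha hb => hreg.2 a b (ha.mono (by norm_num)) (hb.mono (by norm_num))⟩
  have hk : (wordProd n M)⁻¹ k = 2 := by rw [Perm.inv_eq_iff_eq, hM.wordProd_two hn]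
  have h1 : (wordProd n M)⁻¹ 1 = 1 := by
    rw [Perm.inv_eq_iff_eq, wordProd_apply_one hn hM.letters]
  obtain ⟨c, hc, e⟩ := hM.exists_residue_eq (Z := Y ++ M.reverse) (v := 1) (q := n - 2) hn hreg2
    fun m hm => by
      rw [Function.comp, (dom_apply_of_idx_two hn hg h1 hm).2, ← hk, Equiv.apply_eq_iff_eq]
  obtain ⟨c', hc', e'⟩ := hM.exists_coef_append_reverse_eq hn hY'
  refine ⟨_, ?_, tendsto_residue hn hZ hM.letters rfl⟩
  rw [e, Function.comp_assoc, ← Perm.coe_mul, inv_mul_cancel, Perm.coe_one, Function.comp_id,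
    mul_one, e']
  exact mul_ne_zero hc (mul_ne_zero hc' (coef_one_pos hn hy).ne')

end Residue

/-- `q` is defined at `x` and takes the value `z` there. -/
def HasVal {n : ℕ} (x : Fin n → ℂ) (q : KK n) (z : ℂ) : Prop :=
  ∃ a b : MvPolynomial (Fin n) ℂ, eval x b ≠ 0 ∧
    q * algebraMap _ (KK n) b = algebraMap _ (KK n) a ∧ z * eval x b = eval x a

namespace HasVal

variable {n : ℕ} {x : Fin n → ℂ} {q q' : KK n} {z z' : ℂ}

lemma algebraMap (f : MvPolynomial (Fin n) ℂ) : HasVal x (algebraMap _ (KK n) f) (eval x f) :=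
  ⟨f, 1, by simp, by simp, by simp⟩

lemma zero : HasVal x (0 : KK n) 0 := by simpa using algebraMap (x := x) 0

lemma one : HasVal x (1 : KK n) 1 := by simpa using algebraMap (x := x) 1

lemma neg_one_pow (l : ℕ) : HasVal x ((-1 : KK n) ^ l) ((-1) ^ l) := by
  simpa using algebraMap (x := x) ((-1) ^ l)

lemma add (h : HasVal x q z) (h' : HasVal x q' z') : HasVal x (q + q') (z + z') := by
  obtain ⟨a, b, hb, e, f⟩ := h
  obtain ⟨a', b', hb', e', f'⟩ := h'
  refine ⟨a * b' + a' * b, b * b', by simp [hb, hb'], ?_, ?_⟩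
  · simp only [map_mul, map_add, ← e, ← e']
    ring
  · simp only [map_mul, map_add, ← f, ← f']
    ring

lemma mul (h : HasVal x q z) (h' : HasVal x q' z') : HasVal x (q * q') (z * z') := by
  obtain ⟨a, b, hb, e, f⟩ := h
  obtain ⟨a', b', hb', e', f'⟩ := h'
  refine ⟨a * a', b * b', by simp [hb, hb'], ?_, ?_⟩
  · simp only [map_mul, ← e, ← e']
    ring
  · simp only [map_mul, ← f, ← f']
    ring

lemma inv (h : HasVal x q z) (hz : z ≠ 0) : HasVal x q⁻¹ z⁻¹ := by
  obtain ⟨a, b, hb, e, f⟩ := h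
  have ha : eval x a ≠ 0 := f ▸ mul_ne_zero hz hb
  have hq : q ≠ 0 := by
    rintro rfl
    have : a = 0 := by
      rw [zero_mul, eq_comm, FaithfulSMul.algebraMap_eq_zero_iff] at e
      exact e
    simp [this] at ha
  refine ⟨b, a, ha, ?_, ?_⟩
  · rw [← e, inv_mul_cancel_left₀ hq]
  · rw [← f, inv_mul_cancel_left₀ hz]

lemma sum {ι : Type*} (s : Finset ι) {F : ι → KK n} {f : ι → ℂ}
    (h : ∀ i ∈ s, HasVal x (F i) (f i)) : HasVal x (∑ i ∈ s, F i) (∑ i ∈ s, f i) := by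
  classical
  induction s using Finset.induction_on with
  | empty => simpa using zero
  | insert i s hi ih =>
    rw [Finset.sum_insert hi, Finset.sum_insert hi]
    exact (h i (by simp)).add (ih fun j hj => h j (by simp [hj]))

lemma prod {ι : Type*} (s : Finset ι) {F : ι → KK n} {f : ι → ℂ}
    (h : ∀ i ∈ s, HasVal x (F i) (f i)) : HasVal x (∏ i ∈ s, F i) (∏ i ∈ s, f i) := by
  classical
  induction s using Finset.induction_on with
  | empty => simpa using one
  | insert i s hi ih =>
    rw [Finset.prod_insert hi, Finset.prod_insert hi]
    exact (h i (by simp)).mul (ih fun j hj => h j (by simp [hj]))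

lemma unique (h : HasVal x q z) (h' : HasVal x q z') : z = z' := by
  obtain ⟨a, b, hb, e, f⟩ := h
  obtain ⟨a', b', hb', e', f'⟩ := h'
  have key : a * b' = a' * b := by
    apply FaithfulSMul.algebraMap_injective (MvPolynomial (Fin n) ℂ) (KK n)
    simp only [map_mul, ← e, ← e']
    ring
  have := congrArg (eval x) key
  simp only [map_mul, ← f, ← f'] at this
  refine mul_right_cancel₀ (mul_ne_zero hb hb') ?_
  linear_combination this

end HasVal

section Evaluation

variable {n i : ℕ} {L : List ℕ} {h : ℤ → ℝ}

/-- The complex point with coordinates `h 1, …, h n`. -/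
noncomputable def point (n : ℕ) (h : ℤ → ℝ) (i : Fin n) : ℂ := h ((i : ℕ) + 1)

lemma eval_epsPoly (hh : ∀ k, h (-k) = -h k) {k : ℤ} (hk : Idx 1 n k) :
    eval (point n h) (epsPoly n k) = h k := by
  unfold Idx at hk
  unfold epsPoly
  split_ifs with h1 h2
  · simp only [eval_X, point]
    congr 2
    omega
  · simp only [map_neg, eval_X, point]
    rw [← Complex.ofReal_neg, ← hh]
    congr 2
    omega
  · omega

lemma eval_simpleRootPoly (hn : 4 ≤ n) (hh : ∀ k, h (-k) = -h k) (hi : 1 ≤ i) (hin : i ≤ n) :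
    eval (point n h) (simpleRootPoly n i) = rootVal n i h := by
  have ha := rootFst_idx hn hi
  have hb := rootSnd_idx hn hi
  rcases hin.lt_or_eq with hlt | rfl
  · simp only [rootFst, rootSnd, hlt, if_true] at ha hb
    simp only [simpleRootPoly, rootVal, rootFst, rootSnd, hlt, if_true, map_sub,
      eval_epsPoly hh ha, eval_epsPoly hh hb, Complex.ofReal_sub]
  · simp only [rootFst, rootSnd, lt_irrefl, if_false] at ha hb
    have hb' := hb.neg
    rw [neg_neg] at hb'
    simp only [simpleRootPoly, rootVal, rootFst, rootSnd, lt_irrefl, if_false, map_add,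
      eval_epsPoly hh ha, eval_epsPoly hh hb', hh, sub_neg_eq_add, Complex.ofReal_add]

lemma eval_polyAct (hn : 4 ≤ n) (hh : ∀ k, h (-k) = -h k) {w : Perm ℤ} (hw : Gen n w)
    (p : MvPolynomial (Fin n) ℂ) :
    eval (point n h) (polyAct n w p) = eval (point n (h ∘ ⇑w)) p := by
  induction p using MvPolynomial.induction_on with
  | C a => simp [polyAct]
  | add p q hp hq => simp only [map_add, hp, hq]
  | mul_X p i hp =>
    have hi : Idx 1 n ((i : ℕ) + 1) := by unfold Idx; omega
    simp only [map_mul, hp, eval_X]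
    simp only [polyAct, aeval_X, eval_epsPoly hh (hw.idx hn hi), point, Function.comp]

lemma maskedPrefix_cons (E : ℕ → Bool) (k : ℕ) : maskedPrefix n (i :: L) E (k + 1) =
    (if E 0 then simpleRefl n i else 1) * maskedPrefix n L (fun m => E (m + 1)) k := by
  simp only [maskedPrefix, List.range_succ_eq_map, List.map_cons, List.map_map, List.prod_cons]
  rfl

lemma gen_maskedPrefix (hL : IsWord n L) (E : ℕ → Bool) {k : ℕ} (hk : k ≤ L.length) :
    Gen n (maskedPrefix n L E k) := by
  induction L generalizing E k with
  | nil =>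
    obtain rfl : k = 0 := by simpa using hk
    exact Gen.one
  | cons i L ih =>
    obtain ⟨hi, hin⟩ := hL.head
    cases k with
    | zero => exact Gen.one
    | succ k =>
      rw [maskedPrefix_cons]
      have := ih hL.tail (fun m => E (m + 1)) (by simpa using hk)
      split_ifs
      · exact (gen_simpleRefl hi hin).mul this
      · exact Gen.one.mul this

/-- Extension of a mask of length `l` by `false`. -/
def extendMask {l : ℕ} (E : Fin l → Bool) (m : ℕ) : Bool := if h : m < l then E ⟨m, h⟩ else false

lemma extendMask_cons_zero {l : ℕ} (e : Bool) (E : Fin l → Bool) :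
    extendMask (Fin.cons e E : Fin (l + 1) → Bool) 0 = e := by
  simp [extendMask]

lemma extendMask_cons_succ {l : ℕ} (e : Bool) (E : Fin l → Bool) :
    (fun m => extendMask (Fin.cons e E : Fin (l + 1) → Bool) (m + 1)) = extendMask E := by
  funext m
  unfold extendMask
  by_cases h : m < l
  · rw [dif_pos h, dif_pos (by omega)]
    exact Fin.cons_succ (α := fun _ => Bool) e E ⟨m, h⟩
  · rw [dif_neg h, dif_neg (by omega)]

open Classical in
lemma coef_eq_sum (hn : 4 ≤ n) (hL : IsWord n L) (v : Perm ℤ) (h : ℤ → ℝ) :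
    coef n L v h = ∑ E : Fin L.length → Bool,
      if maskedPrefix n L (extendMask E) L.length = v then
        ∏ k ∈ Finset.range L.length,
          (rootVal n (L.getD k 0) (h ∘ ⇑(maskedPrefix n L (extendMask E) (k + 1))))⁻¹
      else 0 := by
  induction L generalizing v h with
  | nil =>
    by_cases hv : v = 1 <;> simp [coef, maskedPrefix, hv, Ne.symm]
  | cons i L ih =>
    obtain ⟨hi, hin⟩ := hL.head
    have hinv (u : Perm ℤ) : simpleRefl n i * u = v ↔ u = simpleRefl n i * v := by
      constructor
      · rintro rfl
        rw [simpleRefl_mul_cancel hn hi hin]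
      · rintro rfl
        rw [simpleRefl_mul_cancel hn hi hin]
    have h0 (E : ℕ → Bool) : maskedPrefix n L E 0 = 1 := by simp [maskedPrefix]
    rw [List.length_cons, ← (Fin.consEquiv fun _ => Bool).sum_comp, Fintype.sum_prod_type,
      Fintype.sum_bool, coef_cons, ih hL.tail, ih hL.tail, sub_div, Finset.sum_div, Finset.sum_div,
      sub_eq_add_neg, add_comm, ← Finset.sum_neg_distrib]
    congr 1
    · refine Finset.sum_congr rfl fun E _ => ?_
      have e0 : extendMask ((Fin.consEquiv fun _ => Bool) (true, E)) 0 = true :=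
        extendMask_cons_zero true E
      have e1 : (fun m => extendMask ((Fin.consEquiv fun _ => Bool) (true, E)) (m + 1)) =
        extendMask E := extendMask_cons_succ true E
      simp only [maskedPrefix_cons, e0, e1, if_true, hinv, Finset.prod_range_succ',
        List.getD_cons_succ, List.getD_cons_zero, h0, mul_one, rootVal_comp_self hn hi hin]
      simp only [Perm.coe_mul, Function.comp_assoc]
      split_ifs
      · rw [inv_neg]
        ring
      · simp
    · refine Finset.sum_congr rfl fun E _ => ?_
      have e0 : extendMask ((Fin.consEquiv fun _ => Bool) (false, E)) 0 = false :=
        extendMask_cons_zero false E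
      have e1 : (fun m => extendMask ((Fin.consEquiv fun _ => Bool) (false, E)) (m + 1)) =
        extendMask E := extendMask_cons_succ false E
      simp only [maskedPrefix_cons, e0, e1, Bool.false_eq_true, if_false, one_mul,
        Finset.prod_range_succ', List.getD_cons_succ, List.getD_cons_zero, h0, Perm.coe_one,
        Function.comp_id]
      split_ifs
      · ring
      · simp

lemma hasVal_dElem (hn : 4 ≤ n) (hL : IsWord n L) (hh : Regular 1 n h) :
    HasVal (point n h) (dElem n L) (coef n L 1 h * eval (point n h) (prodPosRoots n)) := by
  classical
  have key : HasVal (point n h) (cElem n L 1) ((-1) ^ L.length * coef n L 1 h) := by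
    rw [coef_eq_sum hn hL, Complex.ofReal_sum]
    refine (HasVal.neg_one_pow _).mul (HasVal.sum _ fun E _ => ?_)
    change HasVal _ (if maskedPrefix n L (extendMask E) L.length = 1 then _ else 0) _
    split_ifs with hE
    · rw [Complex.ofReal_prod]
      refine HasVal.prod _ fun k hk => ?_
      have hk' : k < L.length := Finset.mem_range.1 hk
      have hg : Gen n (maskedPrefix n L (extendMask E) (k + 1)) := gen_maskedPrefix hL _ hk'
      obtain ⟨hi, hin⟩ : 1 ≤ L.getD k 0 ∧ L.getD k 0 ≤ n := by
        rw [List.getD_eq_getElem _ _ hk']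
        exact hL _ (List.getElem_mem hk')
      have hreg := hh.comp hn hg
      rw [Complex.ofReal_inv, ← eval_simpleRootPoly hn hreg.1 hi hin, ← eval_polyAct hn hh.1 hg]
      refine (HasVal.algebraMap _).inv ?_
      change eval _ (polyAct n (maskedPrefix n L (extendMask E) (k + 1)) _) ≠ 0
      rw [eval_polyAct hn hh.1 hg, eval_simpleRootPoly hn hreg.1 hi hin]
      exact_mod_cast hreg.rootVal_ne hn hi hin
    · simpa using HasVal.zero
  have := ((HasVal.neg_one_pow (x := point n h) L.length).mul key).mul
    (HasVal.algebraMap (prodPosRoots n))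
  rwa [← mul_assoc, ← mul_pow, neg_one_mul, neg_neg, one_pow, one_mul] at this

end Evaluation

section Conclusion

open Filter Topology

variable {n : ℕ} {w : Perm ℤ} {h : ℤ → ℝ} {k : ℤ}

lemma idx_one_iff (hn : 4 ≤ n) : Idx 1 n k ↔ k = 1 ∨ k = -1 ∨ Idx 2 n k := by
  unfold Idx
  omega

lemma updOne_one {t : ℝ} : updOne h t 1 = t := by simp [updOne]

lemma updOne_neg (hh : ∀ k, h (-k) = -h k) (t : ℝ) (k : ℤ) :
    updOne h t (-k) = -updOne h t k := by
  unfold updOne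
  split_ifs <;> first | omega | simp [hh]

lemma Regular.updOne (hn : 4 ≤ n) (hh : Regular 2 n h) {t : ℝ} (ht : ∀ m, Idx 2 n m → h m < t) :
    Regular 1 n (updOne h t) := by
  have hneg (m : ℤ) (hm : Idx 2 n m) : -t < h m := by
    have := ht _ hm.neg
    rw [hh.1] at this
    linarith
  have e1 : _root_.updOne h t (-1) = -t := by rw [updOne_neg hh.1, updOne_one]
  refine ⟨updOne_neg hh.1 t, fun a b ha hb hab hab' => ?_⟩
  rw [idx_one_iff hn] at ha hb
  rcases ha with rfl | rfl | ha <;> rcases hb with rfl | rfl | hb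
  · exact absurd rfl hab
  · exact absurd (by norm_num) hab'
  · rw [updOne_one, updOne_of_idx hb]
    exact (ht b hb).ne'
  · exact absurd rfl hab'
  · exact absurd rfl hab
  · rw [e1, updOne_of_idx hb]
    exact (hneg b hb).ne
  · rw [updOne_one, updOne_of_idx ha]
    exact (ht a ha).ne
  · rw [e1, updOne_of_idx ha]
    exact (hneg a ha).ne'
  · rw [updOne_of_idx ha, updOne_of_idx hb]
    exact hh.2 a b ha hb hab hab'

/-- A root of the support in the first column is `ε₁ - ε_k` with `k = w 1`. -/
lemma eval_root_of_mem {β : MvPolynomial (Fin n) ℂ} (hβ : β ∈ suppPoly n w) (hβ' : β ∈ col1Set n) :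
    Idx 2 n (w 1) ∧ ∀ h : ℤ → ℝ, (∀ k, h (-k) = -h k) →
      eval (point n h) β = h 1 - h (w 1) := by
  classical
  obtain ⟨i, j, hij, hw⟩ := hβ
  have hi : (i : ℕ) = 0 := by
    obtain ⟨a, b, ha, hb, hab⟩ := hβ'
    by_contra hi
    have hia : i ≠ a := by rintro rfl; exact hi ha
    have hja : j ≠ a := by rintro rfl; have := Fin.lt_def.1 hij; omega
    have hba : b ≠ a := by rintro rfl; omega
    have h0 : eval (Pi.single a 1) β = 0 := by
      rcases hw with ⟨-, rfl⟩ | ⟨-, rfl⟩ <;> simp [hia, hja]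
    have h1 : eval (Pi.single a 1) β = 1 := by
      rcases hab with rfl | rfl <;> simp [hba]
    exact one_ne_zero (h1.symm.trans h0)
  have hj : 0 < (j : ℕ) := by have := Fin.lt_def.1 hij; omega
  have := j.2
  simp only [hi, Nat.cast_zero, zero_add] at hw
  refine ⟨?_, fun h hh => ?_⟩
  · unfold Idx
    omega
  · rcases hw with ⟨e, rfl⟩ | ⟨e, rfl⟩
    · simp [e, point, hi]
    · rw [e, hh]
      simp [point, hi]

/-- The product of the positive roots is divisible by `(ε₁ - ε_k)(ε₁ + ε_k)`, and the
cofactor does not vanish where only these roots do. -/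
lemma exists_cofactor (hn : 4 ≤ n) (hk : Idx 2 n k) : ∃ P : MvPolynomial (Fin n) ℂ,
    ∀ h : ℤ → ℝ, (∀ k, h (-k) = -h k) →
      eval (point n h) (prodPosRoots n) = (h 1 - h k) * (h 1 + h k) * eval (point n h) P ∧
      (Regular 2 n h → (∀ m, Idx 2 n m → h m = h 1 → m = k) → h k = h 1 →
        eval (point n h) P ≠ 0) := by
  classical
  have hn0 : 0 < n := by omega
  have hkn : (k.natAbs - 1) < n := by unfold Idx at hk; omega
  set a : Fin n := ⟨0, hn0⟩ with ha
  set j : Fin n := ⟨k.natAbs - 1, hkn⟩ with hj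
  have haj : (a, j) ∈ Finset.univ.filter (fun p : Fin n × Fin n => p.1 < p.2) := by
    simp only [Finset.mem_filter, Finset.mem_univ, true_and, Fin.lt_def, ha, hj]
    unfold Idx at hk
    omega
  refine ⟨∏ p ∈ (Finset.univ.filter (fun p : Fin n × Fin n => p.1 < p.2)).erase (a, j),
    ((X p.1 - X p.2) * (X p.1 + X p.2)), fun h hh => ⟨?_, fun hreg hmax hk1 => ?_⟩⟩
  · rw [prodPosRoots, ← Finset.mul_prod_erase _ _ haj, map_mul]
    congr 1
    have e : ((k.natAbs - 1 : ℕ) : ℤ) + 1 = |k| := by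
      rw [Int.abs_eq_natAbs]
      unfold Idx at hk
      omega
    simp only [map_mul, map_sub, map_add, eval_X, point, ha, hj, e, Nat.cast_zero, zero_add]
    rcases abs_choice k with h' | h' <;> rw [h']
    rw [hh]
    push_cast
    ring
  · rw [map_prod]
    refine Finset.prod_ne_zero_iff.2 fun p hp => ?_
    obtain ⟨c, d⟩ := p
    simp only [Finset.mem_erase, Finset.mem_filter, Finset.mem_univ, true_and, Fin.lt_def, ne_eq,
      Prod.mk.injEq, Fin.ext_iff, ha, hj] at hp
    obtain ⟨hp, hcd⟩ := hp
    have := d.2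
    set x : ℤ := (c : ℕ) + 1 with hx
    set y : ℤ := (d : ℕ) + 1 with hy
    have hyI : Idx 2 n y := by unfold Idx; omega
    have key : h x ≠ h y ∧ h x ≠ h (-y) := by
      rcases Nat.eq_zero_or_pos (c : ℕ) with hc | hc
      · have hx1 : x = 1 := by omega
        rw [hx1]
        refine ⟨fun e => ?_, fun e => ?_⟩
        · have := hmax y hyI e.symm
          omega
        · have := hmax (-y) hyI.neg e.symm
          omega
      · have hxI : Idx 2 n x := by unfold Idx; omega
        exact ⟨hreg.2 _ _ hxI hyI (by omega) (by omega),
          hreg.2 _ _ hxI hyI.neg (by omega) (by omega)⟩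
    rw [hh] at key
    simp only [map_mul, map_sub, map_add, eval_X, point]
    refine mul_ne_zero (sub_ne_zero.2 ?_) fun e => key.2 ?_
    · exact_mod_cast key.1
    · exact_mod_cast eq_neg_of_add_eq_zero_left e

lemma continuous_eval_point_updOne (p : MvPolynomial (Fin n) ℂ) :
    Continuous fun t => eval (point n (updOne h t)) p := by
  refine (MvPolynomial.continuous_eval p).comp (continuous_pi fun i => ?_)
  unfold point updOne
  split_ifs <;> fun_prop

end Conclusion

open Filter Topology in
/-- Let `n ≥ 4` and let `w` be a basic involution in the Weyl group of
type `Dₙ` with `Supp(w) ∩ 𝒞₁ = {β}`. Then `β` does not divide the Kostant–Kumar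
polynomial `d_w`: for every reduced decomposition `L` of `w` there is no polynomial
`g ∈ ℂ[x₁, …, xₙ]` with `d_w = β ⬝ g` in `ℂ(x₁, …, xₙ)`. -/
theorem statement1 (n : ℕ) (hn : 4 ≤ n) (w : Equiv.Perm ℤ)
    (hw : IsBasicInvolution n w) (β : MvPolynomial (Fin n) ℂ)
    (hsupp : suppPoly n w ∩ col1Set n = {β}) :
    ∀ L : List ℕ, IsReducedWord n w L →
      ¬∃ g : MvPolynomial (Fin n) ℂ,
        dElem n L = algebraMap (MvPolynomial (Fin n) ℂ) (KK n) (β * g) := by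
  rintro L hL ⟨p, hp⟩
  obtain ⟨hβ, hβ'⟩ : β ∈ suppPoly n w ∩ col1Set n := hsupp ▸ rfl
  obtain ⟨hk, hβe⟩ := eval_root_of_mem hβ hβ'
  set k := w 1 with hkdef
  have hwk : w k = 1 := by
    rw [hkdef, ← Perm.mul_apply, hw.2.1, Perm.one_apply]
  obtain ⟨M, hM⟩ := exists_path hn hk
  obtain ⟨y, Y, hy, hY, hred⟩ := hM.exists_reduced hn hL.gen rfl hwk
  obtain ⟨A, hA, hlim⟩ := hM.exists_tendsto hn hy hY
  obtain ⟨P, hP⟩ := exists_cofactor hn hk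
  have hg : Gen n (wordProd n M)⁻¹ := (gen_wordProd hM.isWord).inv hn
  have h1 : (wordProd n M)⁻¹ 1 = 1 := by
    rw [Perm.inv_eq_iff_eq, wordProd_apply_one hn hM.letters]
  set h := dom n ∘ ⇑(wordProd n M)⁻¹ with hh
  have hle (m : ℤ) (hm : Idx 2 n m) : h m ≤ n - 2 ∧ (h m = n - 2 ↔ m = k) := by
    have := dom_apply_of_idx_two hn hg h1 hm
    rwa [Perm.inv_eq_iff_eq, hM.wordProd_two hn] at this
  have hreg1 : Regular 1 n h := regular_dom.comp hn hg
  have hreg : Regular 2 n h := ⟨hreg1.1, fun a b ha hb =>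
    hreg1.2 a b (ha.mono (by norm_num)) (hb.mono (by norm_num))⟩
  have hodd (t : ℝ) := updOne_neg hreg.1 t
  have hkq : h k = n - 2 := (hle k hk).2.2 rfl
  have hq : (0 : ℝ) < n - 2 := by
    have : (4 : ℝ) ≤ n := by exact_mod_cast hn
    linarith
  generalize (n : ℝ) - 2 = q at *
  have heq : ∀ᶠ t in 𝓝[>] q, (((t - q) * coef n (M ++ 1 :: (Y ++ M.reverse)) 1 (updOne h t) : ℝ) :
      ℂ) * ((t + q) * eval (point n (updOne h t)) P) =
        (t - q) * eval (point n (updOne h t)) p := by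
    filter_upwards [self_mem_nhdsWithin] with t ht
    have hr : Regular 1 n (updOne h t) := hreg.updOne hn fun m hm => (hle m hm).1.trans_lt ht
    have h1 := hasVal_dElem hn hL.1 hr
    rw [hp] at h1
    have h2 := (HasVal.algebraMap (β * p)).unique h1
    rw [map_mul, hβe _ (hodd t), (hP _ (hodd t)).1, updOne_one, updOne_of_idx hk, hkq,
      coef_eq_of_reduced hn hL hred 1 hr] at h2
    push_cast
    rw [h2]
    ring
  have hlim1 : Tendsto (fun t => (((t - q) * coef n (M ++ 1 :: (Y ++ M.reverse)) 1
      (updOne h t) : ℝ) : ℂ) * ((t + q) * eval (point n (updOne h t)) P)) (𝓝[>] q)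
      (𝓝 (A * ((q + q) * eval (point n (updOne h q)) P))) := by
    refine ((Complex.continuous_ofReal.tendsto A).comp
      (hlim.mono_left (nhdsWithin_mono q fun t ht => (ne_of_gt ht : t ≠ q)))).mul ?_
    have : Continuous fun t : ℝ => ((t : ℂ) + q) * eval (point n (updOne h t)) P :=
      (by fun_prop : Continuous fun t : ℝ => (t : ℂ) + q).mul (continuous_eval_point_updOne P)
    exact (this.tendsto q).mono_left nhdsWithin_le_nhds
  have hlim2 : Tendsto (fun t : ℝ => ((t : ℂ) - q) * eval (point n (updOne h t)) p) (𝓝[>] q)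
      (𝓝 ((q - q) * eval (point n (updOne h q)) p)) := by
    have : Continuous fun t : ℝ => ((t : ℂ) - q) * eval (point n (updOne h t)) p :=
      (by fun_prop : Continuous fun t : ℝ => (t : ℂ) - q).mul (continuous_eval_point_updOne p)
    exact (this.tendsto q).mono_left nhdsWithin_le_nhds
  have hfin := tendsto_nhds_unique_of_eventuallyEq hlim1 hlim2 heq
  rw [sub_self, zero_mul] at hfin
  have hP0 : eval (point n (updOne h q)) P ≠ 0 := by
    refine (hP _ (hodd q)).2 ⟨hodd q, fun a b ha hb => ?_⟩ (fun m hm e => ?_) ?_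
    · rw [updOne_of_idx ha, updOne_of_idx hb]
      exact hreg.2 a b ha hb
    · rw [updOne_of_idx hm, updOne_one] at e
      exact (hle m hm).2.1 e
    · rw [updOne_of_idx hk, updOne_one, hkq]
  have hqq : (q : ℂ) + q ≠ 0 := by exact_mod_cast (by linarith : q + q ≠ 0)
  exact mul_ne_zero (Complex.ofReal_ne_zero.2 hA) (mul_ne_zero hqq hP0) hfin
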